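/- arXiv:math/0605284 — 3 statements merged into one kernel-verified Lean document; each statement's English description precedes it below -/
import Mathlib

section
/- Suppose N > 2 is an integer, δ, μ > 0 satisfy condition (H₁), 2 ≤ p < N and 2 ≤ q < N. If 1/(δ+1) + 1/(μ+1) ≤ (N − M)/(N(M−1)), where M = max{p,q}, then for every R > 0 the system (S_R) has no radial solution, regular or singular: there is no pair (u,v) of real functions on (0,R], continuously differentiable on (0,R] and twice continuously differentiable on (0,R), with u(r) > 0 and v(r) > 0 for all r ∈ (0,R), u(R) = v(R) = 0, satisfying for all r ∈ (0,R): (r^{N−1}|u'(r)|^{p−2}u'(r))' = −r^{N−1} v(r)^δ and (r^{N−1}|v'(r)|^{q−2}v'(r))' = −r^{N−1} u(r)^μ. -/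
/-- A radial solution (regular or singular) of system (S_R): only regularity on `(0,R]` is
required and positivity on `(0,R)`. -/
def IsRadialSolutionAux (N : ℕ) (p q δ μ R : ℝ) (u v : ℝ → ℝ) : Prop :=
  ContDiffOn ℝ 1 u (Set.Ioc 0 R) ∧ ContDiffOn ℝ 1 v (Set.Ioc 0 R) ∧
  ContDiffOn ℝ 2 u (Set.Ioo 0 R) ∧ ContDiffOn ℝ 2 v (Set.Ioo 0 R) ∧
  (∀ r ∈ Set.Ioo (0:ℝ) R, 0 < u r) ∧ (∀ r ∈ Set.Ioo (0:ℝ) R, 0 < v r) ∧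
  u R = 0 ∧ v R = 0 ∧
  (∀ r ∈ Set.Ioo (0:ℝ) R,
    deriv (fun s => s ^ ((N:ℝ) - 1) * |deriv u s| ^ (p - 2) * deriv u s) r
      = -(r ^ ((N:ℝ) - 1) * v r ^ δ)) ∧
  (∀ r ∈ Set.Ioo (0:ℝ) R,
    deriv (fun s => s ^ ((N:ℝ) - 1) * |deriv v s| ^ (q - 2) * deriv v s) r
      = -(r ^ ((N:ℝ) - 1) * u r ^ μ))

open Set Filter Topology

/-- A positive function on `(0, b)` cannot have derivative bounded below by `c / r`. -/
lemma false_of_pos_of_div_le_deriv {f f' : ℝ → ℝ} {b c : ℝ} (hb : 0 < b) (hc : 0 < c)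
    (hf : ∀ r ∈ Ioo 0 b, HasDerivAt f (f' r) r) (hf' : ∀ r ∈ Ioo 0 b, c / r ≤ f' r)
    (hpos : ∀ r ∈ Ioo 0 b, 0 < f r) : False := by
  have hder : ∀ r ∈ Ioo 0 b, HasDerivAt (fun s => f s - c * Real.log s) (f' r - c * r⁻¹) r :=
    fun r hr => (hf r hr).sub ((Real.hasDerivAt_log hr.1.ne').const_mul c)
  have hmono : MonotoneOn (fun s => f s - c * Real.log s) (Ioo 0 b) := by
    refine monotoneOn_of_deriv_nonneg (convex_Ioo 0 b)
      (fun r hr => (hder r hr).continuousAt.continuousWithinAt) ?_ ?_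
    · intro r hr
      rw [interior_Ioo] at hr
      exact (hder r hr).differentiableAt.differentiableWithinAt
    · intro r hr
      rw [interior_Ioo] at hr
      rw [(hder r hr).deriv]
      have := hf' r hr
      rw [div_eq_mul_inv] at this
      linarith
  have h0 : b / 2 ∈ Ioo 0 b := ⟨by linarith, by linarith⟩
  set E := Real.exp (-(f (b / 2) / c)) with hE
  have hE1 : E ≤ 1 := by
    rw [hE, Real.exp_le_one_iff]
    have := div_pos (hpos _ h0) hc
    linarith
  have hE0 : 0 < E := Real.exp_pos _
  have hle : b / 2 * E ≤ b / 2 := by nlinarith [h0.1]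
  have h1 : b / 2 * E ∈ Ioo 0 b := ⟨mul_pos h0.1 hE0, by linarith [h0.2]⟩
  have key := hmono h1 h0 hle
  simp only at key
  rw [Real.log_mul h0.1.ne' hE0.ne', hE, Real.log_exp, ← hE] at key
  have h2 : c * (f (b / 2) / c) = f (b / 2) := by field_simp
  have h3 := hpos _ h1
  nlinarith

/-- Radial flux of a positive supersolution is strictly decreasing, so the solution decreases. -/
lemma deriv_neg_of_radial {n p δ R : ℝ} {u v : ℝ → ℝ} (hp : 1 < p) (hpn : p < n)
    (hu : ∀ r ∈ Ioo 0 R, 0 < u r) (hv : ∀ r ∈ Ioo 0 R, 0 < v r)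
    (hdu : ∀ r ∈ Ioo 0 R, DifferentiableAt ℝ u r)
    (heq : ∀ r ∈ Ioo 0 R, deriv (fun s => s ^ (n - 1) * |deriv u s| ^ (p - 2) * deriv u s) r
      = -(r ^ (n - 1) * v r ^ δ)) :
    ∀ r ∈ Ioo 0 R, deriv u r < 0 := by
  set F : ℝ → ℝ := fun s => s ^ (n - 1) * |deriv u s| ^ (p - 2) * deriv u s with hF
  have hneg : ∀ r ∈ Ioo 0 R, deriv F r < 0 := fun r hr => by
    rw [heq r hr, neg_lt_zero]
    exact mul_pos (Real.rpow_pos_of_pos hr.1 _) (Real.rpow_pos_of_pos (hv r hr) _)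
  have hanti : StrictAntiOn F (Ioo 0 R) := by
    refine strictAntiOn_of_deriv_neg (convex_Ioo 0 R) (fun r hr =>
      (differentiableAt_of_deriv_ne_zero (hneg r hr).ne).continuousAt.continuousWithinAt) ?_
    intro r hr
    rw [interior_Ioo] at hr
    exact hneg r hr
  intro r₁ hr₁
  by_contra! h
  have hF1 : 0 ≤ F r₁ := mul_nonneg (mul_nonneg (Real.rpow_nonneg hr₁.1.le _)
    (Real.rpow_nonneg (abs_nonneg _) _)) h
  set r₀ := r₁ / 2
  have hr₀ : r₀ ∈ Ioo 0 R := ⟨half_pos hr₁.1, (half_lt_self hr₁.1).trans hr₁.2⟩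
  have hc : 0 < F r₀ := hF1.trans_lt (hanti hr₀ hr₁ (half_lt_self hr₁.1))
  set C := F r₀ * r₀ ^ (p - n)
  have hC : 0 < C := mul_pos hc (Real.rpow_pos_of_pos hr₀.1 _)
  have hp1 : 0 < p - 1 := by linarith
  refine false_of_pos_of_div_le_deriv hr₀.1 (Real.rpow_pos_of_pos hC (p - 1)⁻¹)
    (fun r hr => (hdu r ⟨hr.1, hr.2.trans hr₀.2⟩).hasDerivAt) ?_
    (fun r hr => hu r ⟨hr.1, hr.2.trans hr₀.2⟩)
  intro r hr
  have hrR : r ∈ Ioo 0 R := ⟨hr.1, hr.2.trans hr₀.2⟩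
  have hFr : F r₀ < F r := hanti hrR hr₀ hr.2
  have hd : 0 < deriv u r := by
    by_contra! hd
    have : F r ≤ 0 := mul_nonpos_of_nonneg_of_nonpos (mul_nonneg (Real.rpow_nonneg hr.1.le _)
      (Real.rpow_nonneg (abs_nonneg _) _)) hd
    linarith
  have hFd : F r = r ^ (n - 1) * deriv u r ^ (p - 1) := by
    simp only [hF]
    rw [abs_of_pos hd, mul_assoc, ← Real.rpow_add_one hd.ne']
    ring_nf
  have hkey : C ≤ (r * deriv u r) ^ (p - 1) := by
    have h1 : (r * deriv u r) ^ (p - 1) = F r * r ^ (p - n) := by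
      rw [hFd, Real.mul_rpow hr.1.le hd.le, mul_right_comm, ← Real.rpow_add hr.1]
      ring_nf
    rw [h1]
    exact mul_le_mul hFr.le (Real.rpow_le_rpow_of_nonpos hr.1 hr.2.le (by linarith))
      (Real.rpow_nonneg hr₀.1.le _) (hc.trans hFr).le
  rw [div_le_iff₀ hr.1]
  have h2 := Real.rpow_le_rpow hC.le hkey (inv_nonneg.2 hp1.le)
  rw [Real.rpow_rpow_inv (mul_pos hr.1 hd).le hp1.ne'] at h2
  linarith

/-- The quantity `r * v ^ δ / |u'| ^ (p - 1)`, a logarithmic derivative of the flux. -/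
noncomputable def fluxRate (p δ : ℝ) (u v : ℝ → ℝ) (r : ℝ) : ℝ :=
  r * v r ^ δ / (-deriv u r) ^ (p - 1)

/-- The flux `r ^ (n - 1) * |u'| ^ (p - 1)`. -/
noncomputable def radialFlux (n p : ℝ) (u : ℝ → ℝ) (r : ℝ) : ℝ :=
  r ^ (n - 1) * (-deriv u r) ^ (p - 1)

/-- The logarithmic slope `r * |u'| / u`. -/
noncomputable def logSlope (u : ℝ → ℝ) (r : ℝ) : ℝ := r * -deriv u r / u r

lemma radialFlux_pos {n p R : ℝ} {u : ℝ → ℝ} (hneg : ∀ r ∈ Ioo 0 R, deriv u r < 0) :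
    ∀ r ∈ Ioo 0 R, 0 < radialFlux n p u r := fun r hr =>
  mul_pos (Real.rpow_pos_of_pos hr.1 _) (Real.rpow_pos_of_pos (neg_pos.2 (hneg r hr)) _)

lemma fluxRate_pos {p δ R : ℝ} {u v : ℝ → ℝ} (hneg : ∀ r ∈ Ioo 0 R, deriv u r < 0)
    (hv : ∀ r ∈ Ioo 0 R, 0 < v r) : ∀ r ∈ Ioo 0 R, 0 < fluxRate p δ u v r := fun r hr =>
  div_pos (mul_pos hr.1 (Real.rpow_pos_of_pos (hv r hr) _))
    (Real.rpow_pos_of_pos (neg_pos.2 (hneg r hr)) _)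

lemma logSlope_pos {R : ℝ} {u : ℝ → ℝ} (hneg : ∀ r ∈ Ioo 0 R, deriv u r < 0)
    (hu : ∀ r ∈ Ioo 0 R, 0 < u r) : ∀ r ∈ Ioo 0 R, 0 < logSlope u r := fun r hr =>
  div_pos (mul_pos hr.1 (neg_pos.2 (hneg r hr))) (hu r hr)

lemma radialFlux_mul_fluxRate {n p δ R : ℝ} {u v : ℝ → ℝ}
    (hneg : ∀ r ∈ Ioo 0 R, deriv u r < 0) :
    ∀ r ∈ Ioo 0 R, radialFlux n p u r * fluxRate p δ u v r = r ^ n * v r ^ δ := by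
  intro r hr
  have h1 : 0 < (-deriv u r) ^ (p - 1) := Real.rpow_pos_of_pos (neg_pos.2 (hneg r hr)) _
  have h2 : r ^ n = r ^ (n - 1) * r := by
    rw [← Real.rpow_add_one hr.1.ne']
    ring_nf
  rw [radialFlux, fluxRate, h2]
  field_simp

lemma hasDerivAt_radialFlux {n p δ R : ℝ} {u v : ℝ → ℝ}
    (hv : ∀ r ∈ Ioo 0 R, 0 < v r) (hneg : ∀ r ∈ Ioo 0 R, deriv u r < 0)
    (heq : ∀ r ∈ Ioo 0 R, deriv (fun s => s ^ (n - 1) * |deriv u s| ^ (p - 2) * deriv u s) r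
      = -(r ^ (n - 1) * v r ^ δ)) :
    ∀ r ∈ Ioo 0 R, HasDerivAt (radialFlux n p u)
      (radialFlux n p u r / r * fluxRate p δ u v r) r := by
  intro r hr
  have hpos : 0 < r ^ (n - 1) * v r ^ δ :=
    mul_pos (Real.rpow_pos_of_pos hr.1 _) (Real.rpow_pos_of_pos (hv r hr) _)
  have hd := (differentiableAt_of_deriv_ne_zero
    (by rw [heq r hr]; exact (neg_lt_zero.2 hpos).ne)).hasDerivAt.neg
  rw [heq r hr, neg_neg] at hd
  have hval : radialFlux n p u r / r * fluxRate p δ u v r = r ^ (n - 1) * v r ^ δ := by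
    rw [div_mul_eq_mul_div, radialFlux_mul_fluxRate hneg r hr, Real.rpow_sub_one hr.1.ne']
    ring
  rw [hval]
  refine hd.congr_of_eventuallyEq ?_
  filter_upwards [Ioo_mem_nhds hr.1 hr.2] with s hs
  have hs' := hneg s hs
  have h3 : (-deriv u s) ^ (p - 1) = (-deriv u s) ^ (p - 2) * -deriv u s := by
    rw [← Real.rpow_add_one (neg_pos.2 hs').ne']
    ring_nf
  simp only [radialFlux, h3, Pi.neg_apply, abs_of_neg hs']
  ring

lemma hasDerivAt_neg_deriv {n p δ R : ℝ} {u v : ℝ → ℝ} (hp : 1 < p)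
    (hv : ∀ r ∈ Ioo 0 R, 0 < v r) (hneg : ∀ r ∈ Ioo 0 R, deriv u r < 0)
    (heq : ∀ r ∈ Ioo 0 R, deriv (fun s => s ^ (n - 1) * |deriv u s| ^ (p - 2) * deriv u s) r
      = -(r ^ (n - 1) * v r ^ δ)) :
    ∀ r ∈ Ioo 0 R, HasDerivAt (fun s => -deriv u s)
      (-deriv u r / r * ((fluxRate p δ u v r + 1 - n) / (p - 1))) r := by
  intro r hr
  have hp1 : 0 < p - 1 := by linarith
  have hU := neg_pos.2 (hneg r hr)
  have hf : ∀ s ∈ Ioo 0 R, radialFlux n p u s * s ^ (1 - n) = (-deriv u s) ^ (p - 1) := by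
    intro s hs
    rw [radialFlux, mul_right_comm, ← Real.rpow_add hs.1]
    norm_num
  have h1 := (hasDerivAt_radialFlux hv hneg heq r hr).mul
    (Real.hasDerivAt_rpow_const (p := 1 - n) (Or.inl hr.1.ne'))
  have hb : radialFlux n p u r * r ^ (1 - n) ≠ 0 := by
    rw [hf r hr]
    exact (Real.rpow_pos_of_pos hU _).ne'
  have h2 := h1.rpow_const (p := (p - 1)⁻¹) (Or.inl hb)
  have h3 : HasDerivAt (fun s => -deriv u s) _ r := h2.congr_of_eventuallyEq (by
    filter_upwards [Ioo_mem_nhds hr.1 hr.2] with s hs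
    simp only [Pi.mul_apply]
    rw [hf s hs, Real.rpow_rpow_inv (neg_pos.2 (hneg s hs)).le hp1.ne'])
  convert h3 using 1
  simp only [Pi.mul_apply]
  rw [hf r hr, Real.rpow_sub_one (Real.rpow_pos_of_pos hU _).ne',
    Real.rpow_rpow_inv hU.le hp1.ne', Real.rpow_sub_one hr.1.ne']
  have h4 : radialFlux n p u r / r * fluxRate p δ u v r * r ^ (1 - n)
      + radialFlux n p u r * ((1 - n) * (r ^ (1 - n) / r))
      = (radialFlux n p u r * r ^ (1 - n)) * ((fluxRate p δ u v r + 1 - n) / r) := by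
    field_simp
    ring
  rw [h4, hf r hr]
  have := Real.rpow_pos_of_pos hU (p - 1)
  field_simp

lemma hasDerivAt_logSlope {n p δ R : ℝ} {u v : ℝ → ℝ} (hp : 1 < p)
    (hu : ∀ r ∈ Ioo 0 R, 0 < u r) (hv : ∀ r ∈ Ioo 0 R, 0 < v r)
    (hneg : ∀ r ∈ Ioo 0 R, deriv u r < 0)
    (heq : ∀ r ∈ Ioo 0 R, deriv (fun s => s ^ (n - 1) * |deriv u s| ^ (p - 2) * deriv u s) r
      = -(r ^ (n - 1) * v r ^ δ)) :
    ∀ r ∈ Ioo 0 R, HasDerivAt (logSlope u) (logSlope u r / r *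
      (1 + logSlope u r + (fluxRate p δ u v r + 1 - n) / (p - 1))) r := by
  intro r hr
  have hur := hu r hr
  have hd := (differentiableAt_of_deriv_ne_zero (hneg r hr).ne).hasDerivAt
  have h := ((hasDerivAt_id r).mul (hasDerivAt_neg_deriv hp hv hneg heq r hr)).div hd hur.ne'
  refine HasDerivAt.congr_deriv (f' := _) (h.congr_of_eventuallyEq (.of_forall fun s => ?_)) ?_
  · simp [logSlope]
  · simp only [logSlope, id, Pi.mul_apply]
    have := hr.1
    have : p - 1 ≠ 0 := by linarith
    field_simp
    ring

lemma hasDerivAt_fluxRate {n p δ R : ℝ} {u v : ℝ → ℝ}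
    (hv : ∀ r ∈ Ioo 0 R, 0 < v r)
    (hneg : ∀ r ∈ Ioo 0 R, deriv u r < 0) (hnegv : ∀ r ∈ Ioo 0 R, deriv v r < 0)
    (heq : ∀ r ∈ Ioo 0 R, deriv (fun s => s ^ (n - 1) * |deriv u s| ^ (p - 2) * deriv u s) r
      = -(r ^ (n - 1) * v r ^ δ)) :
    ∀ r ∈ Ioo 0 R, HasDerivAt (fluxRate p δ u v) (fluxRate p δ u v r / r *
      (n - δ * logSlope v r - fluxRate p δ u v r)) r := by
  intro r hr
  have hvr := hv r hr
  have hd := (differentiableAt_of_deriv_ne_zero (hnegv r hr).ne).hasDerivAt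
  have hP := radialFlux_pos (n := n) (p := p) hneg r hr
  have h := ((Real.hasDerivAt_rpow_const (p := n) (Or.inl hr.1.ne')).mul
    (hd.rpow_const (p := δ) (Or.inl hvr.ne'))).div (hasDerivAt_radialFlux hv hneg heq r hr) hP.ne'
  have hform : ∀ s ∈ Ioo 0 R, fluxRate p δ u v s = s ^ n * v s ^ δ / radialFlux n p u s :=
    fun s hs => by
      rw [← radialFlux_mul_fluxRate hneg s hs,
        mul_div_cancel_left₀ _ (radialFlux_pos hneg s hs).ne']
  refine HasDerivAt.congr_deriv (f' := _) (h.congr_of_eventuallyEq ?_) ?_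
  · filter_upwards [Ioo_mem_nhds hr.1 hr.2] with s hs using hform s hs
  · simp only [Pi.mul_apply]
    rw [hform r hr, Real.rpow_sub_one hr.1.ne', Real.rpow_sub_one hvr.ne', logSlope]
    have := hr.1
    field_simp
    ring

lemma fluxRate_le {n p δ R : ℝ} {u v : ℝ → ℝ} (hn : 0 < n) (hδ : 0 < δ)
    (hv : ∀ r ∈ Ioo 0 R, 0 < v r)
    (hneg : ∀ r ∈ Ioo 0 R, deriv u r < 0) (hnegv : ∀ r ∈ Ioo 0 R, deriv v r < 0)
    (heq : ∀ r ∈ Ioo 0 R, deriv (fun s => s ^ (n - 1) * |deriv u s| ^ (p - 2) * deriv u s) r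
      = -(r ^ (n - 1) * v r ^ δ)) :
    ∀ r ∈ Ioo 0 R, fluxRate p δ u v r ≤ n := by
  have hder : ∀ r ∈ Ioo 0 R, HasDerivAt
      (fun s => radialFlux n p u s * (n - fluxRate p δ u v s))
      (radialFlux n p u r / r * (δ * logSlope v r * fluxRate p δ u v r)) r := by
    intro r hr
    refine ((hasDerivAt_radialFlux hv hneg heq r hr).mul
      ((hasDerivAt_fluxRate hv hneg hnegv heq r hr).const_sub n)).congr_deriv ?_
    have := hr.1
    field_simp
    ring
  have hmono : MonotoneOn (fun s => radialFlux n p u s * (n - fluxRate p δ u v s)) (Ioo 0 R) := by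
    refine monotoneOn_of_deriv_nonneg (convex_Ioo 0 R)
      (fun r hr => (hder r hr).continuousAt.continuousWithinAt) ?_ ?_
    · intro r hr
      rw [interior_Ioo] at hr
      exact (hder r hr).differentiableAt.differentiableWithinAt
    · intro r hr
      rw [interior_Ioo] at hr
      rw [(hder r hr).deriv]
      have h1 := radialFlux_pos (n := n) (p := p) hneg r hr
      have h2 := fluxRate_pos (p := p) (δ := δ) hneg hv r hr
      have h3 := logSlope_pos hnegv hv r hr
      have := hr.1
      positivity
  intro r₀ hr₀
  by_contra! h
  have hP := radialFlux_pos (n := n) (p := p) hneg r₀ hr₀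
  set c := radialFlux n p u r₀ * (fluxRate p δ u v r₀ - n) with hc
  have hc0 : 0 < c := mul_pos hP (by linarith)
  refine false_of_pos_of_div_le_deriv hr₀.1 hc0 (fun r hr => hasDerivAt_radialFlux hv hneg heq r
    ⟨hr.1, hr.2.trans hr₀.2⟩) (fun r hr => ?_)
    (fun r hr => radialFlux_pos hneg r ⟨hr.1, hr.2.trans hr₀.2⟩)
  have hrR : r ∈ Ioo 0 R := ⟨hr.1, hr.2.trans hr₀.2⟩
  have h1 := hmono hrR hr₀ hr.2.le
  simp only at h1
  have h2 := radialFlux_pos (n := n) (p := p) hneg r hrR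
  rw [div_mul_eq_mul_div]
  gcongr
  · exact hr.1.le
  · nlinarith

/-- Along a minimizing sequence at `-∞`, chosen well, the first derivative vanishes and the second
derivative is asymptotically nonnegative. -/
lemma exists_seq_minimizing_atBot {f f' f'' : ℝ → ℝ} {T B : ℝ}
    (hf : ∀ t < T, HasDerivAt f (f' t) t) (hf' : ∀ t < T, HasDerivAt f' (f'' t) t)
    (h0 : ∀ t < T, 0 < f t) (hB : ∀ t < T, f t ≤ B) :
    ∃ (l : ℝ) (s : ℕ → ℝ), Tendsto s atTop atBot ∧ Tendsto (fun i => f (s i)) atTop (𝓝 l) ∧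
      Tendsto (fun i => f' (s i)) atTop (𝓝 0) ∧ (∃ e : ℕ → ℝ, Tendsto e atTop (𝓝 0) ∧
        ∀ i, -e i ≤ f'' (s i)) ∧
      ∀ (a : ℕ → ℝ) (x : ℝ), Tendsto a atTop atBot → Tendsto (fun i => f (a i)) atTop (𝓝 x) →
        l ≤ x := by
  set l := liminf f atBot with hl
  have hbdd : IsBoundedUnder (· ≥ ·) atBot f :=
    ⟨0, eventually_map.2 ((eventually_lt_atBot T).mono fun t ht => (h0 t ht).le)⟩
  have hcobdd : IsCoboundedUnder (· ≥ ·) atBot f :=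
    IsBoundedUnder.isCoboundedUnder_ge
      ⟨B, eventually_map.2 ((eventually_lt_atBot T).mono fun t ht => hB t ht)⟩
  have hev : ∀ η > 0, ∀ᶠ t in atBot, l - η < f t := fun η hη =>
    eventually_lt_of_lt_liminf (by linarith) hbdd
  have hfr : ∀ η > 0, ∃ᶠ t in atBot, f t < l + η := fun η hη =>
    frequently_lt_of_liminf_lt hcobdd (by linarith)
  have key : ∀ η > 0, ∀ t₀ : ℝ, ∃ t < t₀, l - η < f t ∧ f t < l + η ∧ |f' t| ≤ 6 * η ∧
      -(6 * η) ≤ f'' t := by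
    intro η hη t₀
    obtain ⟨t₁, ht₁⟩ := eventually_atBot.1 (hev η hη)
    obtain ⟨c, hcl, hc⟩ := ((hfr η hη).and_eventually
      (eventually_lt_atBot (min (min t₀ t₁) T - 1))).exists
    have hc0 : c + 1 < t₀ := by
      have := (min_le_left (min t₀ t₁) T).trans (min_le_left _ _); linarith
    have hc1 : c + 1 < t₁ := by
      have := (min_le_left (min t₀ t₁) T).trans (min_le_right _ _); linarith
    have hcT : c + 1 < T := by have := min_le_right (min t₀ t₁) T; linarith
    set g : ℝ → ℝ := fun t => f t + 3 * η * (t - c) ^ 2 with hg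
    have hgd : ∀ t < T, HasDerivAt g (f' t + 6 * η * (t - c)) t := fun t ht => by
      refine ((hf t ht).add ((((hasDerivAt_id t).sub_const c).pow 2).const_mul
        (3 * η))).congr_deriv ?_
      simp only [id]
      ring
    have hgdd : ∀ t < T, HasDerivAt (fun t => f' t + 6 * η * (t - c)) (f'' t + 6 * η) t :=
      fun t ht => by
        refine ((hf' t ht).add (((hasDerivAt_id t).sub_const c).const_mul (6 * η))).congr_deriv ?_
        ring
    obtain ⟨t, htI, hmin⟩ := isCompact_Icc.exists_isMinOn (s := Icc (c - 1) (c + 1))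
      ⟨c, by simp⟩ (f := g) (fun t ht =>
        (hgd t (ht.2.trans_lt hcT)).continuousAt.continuousWithinAt)
    have htc : g t ≤ f c := by
      have := hmin (show c ∈ Icc (c - 1) (c + 1) by simp)
      simpa [hg] using this
    have htl : l - η < f t := ht₁ t (htI.2.trans hc1.le)
    have hsq : (t - c) ^ 2 < 1 := by
      simp only [hg] at htc
      nlinarith
    have habs : |t - c| < 1 := by
      rw [sq_lt_one_iff_abs_lt_one] at hsq; exact hsq
    have htoo : t ∈ Ioo (c - 1) (c + 1) := by
      rw [abs_lt] at habs
      exact ⟨by linarith, by linarith⟩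
    have htT : t < T := htI.2.trans_lt hcT
    have hloc : IsLocalMin g t := hmin.isLocalMin (Icc_mem_nhds htoo.1 htoo.2)
    have hz : f' t + 6 * η * (t - c) = 0 := hloc.hasDerivAt_eq_zero (hgd t htT)
    have hderiv : deriv g =ᶠ[𝓝 t] fun t => f' t + 6 * η * (t - c) := by
      filter_upwards [Iio_mem_nhds htT] with s hs using (hgd s hs).deriv
    have hdd : deriv (deriv g) t = f'' t + 6 * η := by
      rw [hderiv.deriv_eq, (hgdd t htT).deriv]
    have hpos : 0 ≤ f'' t + 6 * η := by
      by_contra! hlt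
      rw [← hdd] at hlt
      have hmax : IsLocalMax g t := isLocalMax_of_deriv_deriv_neg hlt
        (by rw [(hgd t htT).deriv, hz]) (hgd t htT).continuousAt
      have hconst : g =ᶠ[𝓝 t] fun _ => g t := by
        filter_upwards [hloc, hmax] with s h1 h2 using le_antisymm h2 h1
      have h1 : deriv g =ᶠ[𝓝 t] fun _ => 0 := by
        have := hconst.deriv
        simpa using this
      rw [h1.deriv_eq] at hlt
      simp at hlt
    refine ⟨t, by linarith [htI.2], htl, ?_, ?_, by linarith⟩
    · have : f t ≤ g t := by simp only [hg]; nlinarith [sq_nonneg (t - c)]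
      linarith
    · have : f' t = -(6 * η * (t - c)) := by linarith
      rw [this, abs_neg, abs_mul, abs_of_pos (by positivity)]
      nlinarith
  choose! s hs using fun i : ℕ => key (1 / ((i : ℝ) + 1)) (by positivity) (-(i : ℝ))
  have hlim : Tendsto (fun i : ℕ => 1 / ((i : ℝ) + 1)) atTop (𝓝 0) :=
    tendsto_one_div_add_atTop_nhds_zero_nat
  have hlim6 : Tendsto (fun i : ℕ => 6 * (1 / ((i : ℝ) + 1))) atTop (𝓝 0) := by
    simpa using hlim.const_mul 6
  refine ⟨l, s, ?_, ?_, ?_, ⟨_, hlim6, fun i => (hs i).2.2.2.2⟩, ?_⟩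
  · exact tendsto_atBot_mono (fun i => (hs i).1.le)
      (tendsto_neg_atTop_atBot.comp tendsto_natCast_atTop_atTop)
  · refine tendsto_of_tendsto_of_tendsto_of_le_of_le (g := fun i : ℕ => l - 1 / ((i : ℝ) + 1))
      (h := fun i : ℕ => l + 1 / ((i : ℝ) + 1)) ?_ ?_ (fun i => (hs i).2.1.le)
      (fun i => (hs i).2.2.1.le)
    · simpa using hlim.const_sub l
    · simpa using hlim.const_add l
  · exact squeeze_zero_norm (fun i => (hs i).2.2.2.1) hlim6
  · intro a x ha hx
    refine le_of_forall_pos_le_add fun η hη => ?_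
    have := ge_of_tendsto hx ((ha.eventually (hev η hη)).mono fun i hi => hi.le)
    linarith

/-- Nonexistence of bounded positive backward-global orbits of positive energy for the critical
Hamiltonian system. -/
lemma false_of_energy_pos {w z w₁ z₁ : ℝ → ℝ} {T B γ k δ μ E : ℝ} (hk : 0 < k) (hδ : 0 < δ)
    (hμ : 0 < μ) (hδμ : 1 < δ * μ) (hE : 0 < E)
    (hw : ∀ t < T, HasDerivAt w (w₁ t) t) (hz : ∀ t < T, HasDerivAt z (z₁ t) t)
    (hw₁ : ∀ t < T, HasDerivAt w₁ (γ * w₁ t + k * w t - z t ^ δ) t)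
    (hz₁ : ∀ t < T, HasDerivAt z₁ (-γ * z₁ t + k * z t - w t ^ μ) t)
    (hw0 : ∀ t < T, 0 < w t) (hz0 : ∀ t < T, 0 < z t)
    (hwB : ∀ t < T, w t ≤ B) (hzB : ∀ t < T, z t ≤ B) (hzB₁ : ∀ t < T, |z₁ t| ≤ B)
    (hen : ∀ t < T, E ≤ w₁ t * z₁ t - k * w t * z t + z t * z t ^ δ / (δ + 1)
      + w t * w t ^ μ / (μ + 1)) : False := by
  obtain ⟨a, s, hs, hsw, hsw₁, ⟨e, he, hse⟩, ha⟩ :=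
    exists_seq_minimizing_atBot hw hw₁ hw0 hwB
  obtain ⟨b, s', hs', hsz, hsz₁, ⟨e', he', hse'⟩, hb⟩ :=
    exists_seq_minimizing_atBot hz hz₁ hz0 hzB
  have hsT : ∀ᶠ i in atTop, s i < T := hs.eventually (eventually_lt_atBot T)
  have hsT' : ∀ᶠ i in atTop, s' i < T := hs'.eventually (eventually_lt_atBot T)
  have ha0 : 0 ≤ a := ge_of_tendsto hsw (hsT.mono fun i hi => (hw0 _ hi).le)
  have hb0 : 0 ≤ b := ge_of_tendsto hsz (hsT'.mono fun i hi => (hz0 _ hi).le)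
  obtain ⟨ζ, hζ, φ, hφ, hzφ⟩ := isCompact_Icc.tendsto_subseq' (x := fun i => z (s i))
    (s := Icc 0 B) (hsT.mono fun i hi => ⟨(hz0 _ hi).le, hzB _ hi⟩).frequently
  obtain ⟨ω, hω, ψ, hψ, hwψ⟩ := isCompact_Icc.tendsto_subseq' (x := fun i => w (s' i))
    (s := Icc 0 B) (hsT'.mono fun i hi => ⟨(hw0 _ hi).le, hwB _ hi⟩).frequently
  have hφt := hφ.tendsto_atTop
  have hψt := hψ.tendsto_atTop
  have hbζ : b ≤ ζ := hb (fun i => s (φ i)) ζ (hs.comp hφt) hzφ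
  have haω : a ≤ ω := ha (fun i => s' (ψ i)) ω (hs'.comp hψt) hwψ
  have hζδ : ζ ^ δ ≤ k * a := by
    have h1 : Tendsto (fun i => z (s (φ i)) ^ δ) atTop (𝓝 (ζ ^ δ)) :=
      hzφ.rpow_const (Or.inr hδ.le)
    have h2 : Tendsto (fun i => γ * w₁ (s (φ i)) + k * w (s (φ i)) + e (φ i)) atTop
        (𝓝 (γ * 0 + k * a + 0)) :=
      (((hsw₁.comp hφt).const_mul γ).add ((hsw.comp hφt).const_mul k)).add (he.comp hφt)
    have := le_of_tendsto_of_tendsto' h1 h2 fun i => by linarith [hse (φ i)]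
    linarith
  have hωμ : ω ^ μ ≤ k * b := by
    have h1 : Tendsto (fun i => w (s' (ψ i)) ^ μ) atTop (𝓝 (ω ^ μ)) :=
      hwψ.rpow_const (Or.inr hμ.le)
    have h2 : Tendsto (fun i => -γ * z₁ (s' (ψ i)) + k * z (s' (ψ i)) + e' (ψ i)) atTop
        (𝓝 (-γ * 0 + k * b + 0)) :=
      (((hsz₁.comp hψt).const_mul (-γ)).add ((hsz.comp hψt).const_mul k)).add (he'.comp hψt)
    have := le_of_tendsto_of_tendsto' h1 h2 fun i => by linarith [hse' (ψ i)]
    linarith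
  have hEle : E ≤ 0 - k * a * ζ + ζ * ζ ^ δ / (δ + 1) + a * a ^ μ / (μ + 1) := by
    have h1 : Tendsto (fun i => w₁ (s (φ i)) * z₁ (s (φ i))) atTop (𝓝 0) := by
      refine bdd_le_mul_tendsto_zero' B ?_ (hsw₁.comp hφt) |>.congr fun i => mul_comm _ _
      exact (hφt.eventually hsT).mono fun i hi => hzB₁ _ hi
    have hwφ := hsw.comp hφt
    have h2 := ((h1.sub ((hwφ.const_mul k).mul hzφ)).add
      ((hzφ.mul (hzφ.rpow_const (Or.inr hδ.le))).div_const (δ + 1))).add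
      ((hwφ.mul (hwφ.rpow_const (p := μ) (Or.inr hμ.le))).div_const (μ + 1))
    exact ge_of_tendsto h2 ((hφt.eventually hsT).mono fun i hi => hen _ hi)
  have haμ : a ^ μ ≤ k * ζ := by
    have := Real.rpow_le_rpow ha0 haω hμ.le
    nlinarith
  have h3 : ζ * ζ ^ δ / (δ + 1) ≤ ζ * (k * a) / (δ + 1) := by gcongr; exact hζ.1
  have h4 : a * a ^ μ / (μ + 1) ≤ a * (k * ζ) / (μ + 1) := by gcongr
  have h5 : 0 - k * a * ζ + ζ * (k * a) / (δ + 1) + a * (k * ζ) / (μ + 1)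
      = -(k * a * ζ * (δ * μ - 1) / ((δ + 1) * (μ + 1))) := by
    field_simp
    ring
  have h6 : 0 ≤ k * a * ζ * (δ * μ - 1) / ((δ + 1) * (μ + 1)) :=
    div_nonneg (mul_nonneg (mul_nonneg (mul_nonneg hk.le ha0) hζ.1) (by linarith)) (by positivity)
  linarith

/-- A Pohozaev-type functional, written in logarithmic variables, is nonincreasing. -/
lemma antitoneOn_pohozaev {n p q δ μ κ R : ℝ} {X Y Z W P Q : ℝ → ℝ} (hp : 2 ≤ p) (hq : 2 ≤ q)
    (hδ : 0 < δ) (hμ : 0 < μ) (hκp : κ ≤ (n - p) / (p - 1)) (hκq : κ ≤ (n - q) / (q - 1))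
    (hκ : n * (1 / (δ + 1) + 1 / (μ + 1)) ≤ κ)
    (hX : ∀ r ∈ Ioo 0 R, HasDerivAt X (X r / r * (1 + X r + (Z r + 1 - n) / (p - 1))) r)
    (hY : ∀ r ∈ Ioo 0 R, HasDerivAt Y (Y r / r * (1 + Y r + (W r + 1 - n) / (q - 1))) r)
    (hZ : ∀ r ∈ Ioo 0 R, HasDerivAt Z (Z r / r * (n - δ * Y r - Z r)) r)
    (hW : ∀ r ∈ Ioo 0 R, HasDerivAt W (W r / r * (n - μ * X r - W r)) r)
    (hP : ∀ r ∈ Ioo 0 R, HasDerivAt P (P r / r * Z r) r)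
    (hQ : ∀ r ∈ Ioo 0 R, HasDerivAt Q (Q r / r * W r) r)
    (hX0 : ∀ r ∈ Ioo 0 R, 0 < X r) (hY0 : ∀ r ∈ Ioo 0 R, 0 < Y r)
    (hZ0 : ∀ r ∈ Ioo 0 R, 0 < Z r) (hW0 : ∀ r ∈ Ioo 0 R, 0 < W r)
    (hP0 : ∀ r ∈ Ioo 0 R, 0 < P r) (hQ0 : ∀ r ∈ Ioo 0 R, 0 < Q r)
    (hZn : ∀ r ∈ Ioo 0 R, Z r ≤ n) (hWn : ∀ r ∈ Ioo 0 R, W r ≤ n) :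
    AntitoneOn (fun r => r ^ (-κ) * (P r * Q r) *
      (1 - (n - Z r) / ((δ + 1) * Y r) - (n - W r) / ((μ + 1) * X r))) (Ioo 0 R) := by
  have hder : ∀ r ∈ Ioo 0 R, HasDerivAt (fun r => r ^ (-κ) * (P r * Q r) *
      (1 - (n - Z r) / ((δ + 1) * Y r) - (n - W r) / ((μ + 1) * X r)))
      (r ^ (-κ) * (P r * Q r) / r * ((Z r + W r - κ) *
        (1 - (n - Z r) / ((δ + 1) * Y r) - (n - W r) / ((μ + 1) * X r))
        - (Z r - n / (δ + 1) - (n - Z r) / ((δ + 1) * Y r) * (Z r + 1 + (W r + 1 - n) / (q - 1)))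
        - (W r - n / (μ + 1) - (n - W r) / ((μ + 1) * X r) *
          (W r + 1 + (Z r + 1 - n) / (p - 1))))) r := by
    intro r hr
    have hr0 := hr.1
    have hx := hX0 r hr
    have hy := hY0 r hr
    have ha : HasDerivAt (fun r => (n - Z r) / ((δ + 1) * Y r)) (1 / r * (Z r - n / (δ + 1) -
        (n - Z r) / ((δ + 1) * Y r) * (Z r + 1 + (W r + 1 - n) / (q - 1)))) r := by
      refine (((hZ r hr).const_sub n).div ((hY r hr).const_mul (δ + 1))
        (by positivity)).congr_deriv ?_
      have : q - 1 ≠ 0 := by linarith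
      field_simp
      ring
    have hb : HasDerivAt (fun r => (n - W r) / ((μ + 1) * X r)) (1 / r * (W r - n / (μ + 1) -
        (n - W r) / ((μ + 1) * X r) * (W r + 1 + (Z r + 1 - n) / (p - 1)))) r := by
      refine (((hW r hr).const_sub n).div ((hX r hr).const_mul (μ + 1))
        (by positivity)).congr_deriv ?_
      have : p - 1 ≠ 0 := by linarith
      field_simp
      ring
    have h := ((Real.hasDerivAt_rpow_const (p := -κ) (Or.inl hr0.ne')).mul
      ((hP r hr).mul (hQ r hr))).mul ((ha.const_sub 1).sub hb)
    refine h.congr_deriv ?_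
    simp only [Pi.mul_apply, Pi.sub_apply]
    rw [Real.rpow_sub_one hr0.ne']
    generalize (n - Z r) / ((δ + 1) * Y r) = a
    generalize (n - W r) / ((μ + 1) * X r) = b
    generalize n / (δ + 1) = c
    generalize n / (μ + 1) = d
    generalize (W r + 1 - n) / (q - 1) = f
    generalize (Z r + 1 - n) / (p - 1) = g
    field_simp
    ring
  refine antitoneOn_of_deriv_nonpos (convex_Ioo 0 R)
    (fun r hr => (hder r hr).continuousAt.continuousWithinAt) ?_ ?_
  · intro r hr
    rw [interior_Ioo] at hr
    exact (hder r hr).differentiableAt.differentiableWithinAt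
  · intro r hr
    rw [interior_Ioo] at hr
    rw [(hder r hr).deriv]
    have hr0 := hr.1
    have hm : 0 ≤ r ^ (-κ) * (P r * Q r) / r := by
      have := hP0 r hr
      have := hQ0 r hr
      positivity
    refine mul_nonpos_of_nonneg_of_nonpos hm ?_
    have ha : 0 ≤ (n - Z r) / ((δ + 1) * Y r) :=
      div_nonneg (by linarith [hZn r hr]) (mul_pos (by linarith) (hY0 r hr)).le
    have hb : 0 ≤ (n - W r) / ((μ + 1) * X r) :=
      div_nonneg (by linarith [hWn r hr]) (mul_pos (by linarith) (hX0 r hr)).le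
    have haux : ∀ s x : ℝ, 2 ≤ s → 0 < x → κ ≤ (n - s) / (s - 1) →
        1 + (x + 1 - n) / (s - 1) ≤ x - κ := by
      intro s x hs hx hκs
      have h1 : 1 + (x + 1 - n) / (s - 1) = x / (s - 1) - (n - s) / (s - 1) := by
        have : s - 1 ≠ 0 := by linarith
        field_simp
        ring
      have h2 : x / (s - 1) ≤ x := div_le_self hx.le (by linarith)
      linarith
    have h1 := mul_le_mul_of_nonneg_left (haux q (W r) hq (hW0 r hr) hκq) ha
    have h2 := mul_le_mul_of_nonneg_left (haux p (Z r) hp (hZ0 r hr) hκp) hb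
    have h3 : n * (1 / (δ + 1) + 1 / (μ + 1)) = n / (δ + 1) + n / (μ + 1) := by ring
    rw [h3] at hκ
    nlinarith

lemma logSlope_le {n p δ R r₁ : ℝ} {u v : ℝ → ℝ} (hp : 1 < p)
    (hu : ∀ r ∈ Ioo 0 R, 0 < u r) (hv : ∀ r ∈ Ioo 0 R, 0 < v r)
    (hneg : ∀ r ∈ Ioo 0 R, deriv u r < 0)
    (heq : ∀ r ∈ Ioo 0 R, deriv (fun s => s ^ (n - 1) * |deriv u s| ^ (p - 2) * deriv u s) r
      = -(r ^ (n - 1) * v r ^ δ)) (hr₁ : r₁ ∈ Ioo 0 R) :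
    ∀ r ∈ Ioc 0 r₁, logSlope u r ≤ max ((n - p) / (p - 1)) (logSlope u r₁) := by
  set K := max ((n - p) / (p - 1)) (logSlope u r₁)
  have hp1 : 0 < p - 1 := by linarith
  have hder : ∀ r ∈ Ioo 0 R, HasDerivAt (fun s => K * u s - s * -deriv u s)
      (-(-deriv u r * (K - (n - p) / (p - 1) + fluxRate p δ u v r / (p - 1)))) r := by
    intro r hr
    have hd := (differentiableAt_of_deriv_ne_zero (hneg r hr).ne).hasDerivAt
    refine ((hd.const_mul K).sub
      ((hasDerivAt_id r).mul (hasDerivAt_neg_deriv hp hv hneg heq r hr))).congr_deriv ?_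
    have := hr.1
    simp only [id]
    field_simp
    ring
  have hanti : AntitoneOn (fun s => K * u s - s * -deriv u s) (Ioo 0 R) := by
    refine antitoneOn_of_deriv_nonpos (convex_Ioo 0 R)
      (fun r hr => (hder r hr).continuousAt.continuousWithinAt) ?_ ?_
    · intro r hr
      rw [interior_Ioo] at hr
      exact (hder r hr).differentiableAt.differentiableWithinAt
    · intro r hr
      rw [interior_Ioo] at hr
      rw [(hder r hr).deriv, neg_nonpos]
      have h1 := div_pos (fluxRate_pos (p := p) (δ := δ) hneg hv r hr) hp1
      have h2 := le_max_left ((n - p) / (p - 1)) (logSlope u r₁)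
      exact mul_nonneg (neg_pos.2 (hneg r hr)).le (by linarith)
  intro r hr
  have hrR : r ∈ Ioo 0 R := ⟨hr.1, hr.2.trans_lt hr₁.2⟩
  have h1 := hanti hrR hr₁ hr.2
  have h2 : logSlope u r₁ ≤ K := le_max_right _ _
  simp only at h1
  rw [logSlope, div_le_iff₀ (hu _ hr₁)] at h2
  rw [logSlope, div_le_iff₀ (hu _ hrR)]
  linarith

lemma le_of_rpow_coupling {w z C₁ C₂ δ μ a b : ℝ} (hw : 0 < w) (hz : 0 < z) (hC₁ : 0 < C₁)
    (hC₂ : 0 < C₂) (hδ : 0 < δ) (hb : 0 < b) (hD : 0 < δ * μ - a * b)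
    (h₁ : z ^ δ ≤ C₁ * w ^ a) (h₂ : w ^ μ ≤ C₂ * z ^ b) :
    w ≤ (C₂ ^ δ * C₁ ^ b) ^ (δ * μ - a * b)⁻¹ := by
  have h3 : w ^ (μ * δ) ≤ C₂ ^ δ * z ^ (δ * b) := by
    have := Real.rpow_le_rpow (by positivity) h₂ hδ.le
    rwa [Real.mul_rpow hC₂.le (by positivity), ← Real.rpow_mul hw.le, ← Real.rpow_mul hz.le,
      mul_comm b] at this
  have h4 : z ^ (δ * b) ≤ C₁ ^ b * w ^ (a * b) := by
    have := Real.rpow_le_rpow (by positivity) h₁ hb.le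
    rwa [Real.mul_rpow hC₁.le (by positivity), ← Real.rpow_mul hw.le, ← Real.rpow_mul hz.le]
      at this
  have h5 : w ^ (δ * μ - a * b) ≤ C₂ ^ δ * C₁ ^ b := by
    rw [Real.rpow_sub hw, div_le_iff₀ (by positivity), mul_comm δ μ, mul_assoc]
    exact h3.trans (by gcongr)
  have h6 := Real.rpow_le_rpow (by positivity) h5 (inv_nonneg.2 hD.le)
  rwa [Real.rpow_rpow_inv hw.le hD.ne'] at h6

lemma scaled_rpow_le {n p δ α β K r : ℝ} {u v : ℝ → ℝ} (hp : 1 < p) (hr : 0 < r)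
    (hu : 0 < u r) (hv : 0 < v r) (hneg : deriv u r < 0) (hαβ : α * (p - 1) + p = β * δ)
    (hK : logSlope u r ≤ K) (hZ : fluxRate p δ u v r ≤ n) (hn : 0 < n) :
    (r ^ β * v r) ^ δ ≤ n * K ^ (p - 1) * (r ^ α * u r) ^ (p - 1) := by
  have hU := neg_pos.2 hneg
  have hUp := Real.rpow_pos_of_pos hU (p - 1)
  rw [fluxRate, div_le_iff₀ hUp] at hZ
  rw [logSlope, div_le_iff₀ hu] at hK
  have hK0 : 0 ≤ K := by
    have := mul_pos hr hU
    by_contra! h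
    nlinarith
  have hp1 : 0 < p - 1 := by linarith
  have h1 := Real.rpow_le_rpow (mul_pos hr hU).le hK hp1.le
  rw [Real.mul_rpow hr.le hU.le, Real.mul_rpow hK0 hu.le] at h1
  have h2 : r ^ (β * δ) = r ^ (α * (p - 1)) * (r ^ (p - 1) * r) := by
    rw [← Real.rpow_add_one hr.ne', ← Real.rpow_add hr, ← hαβ]
    ring_nf
  rw [Real.mul_rpow (by positivity) hv.le, Real.mul_rpow (by positivity) hu.le,
    ← Real.rpow_mul hr.le, ← Real.rpow_mul hr.le, h2]
  have h3 : r ^ (p - 1) * (r * v r ^ δ) ≤ n * (K ^ (p - 1) * u r ^ (p - 1)) := by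
    calc r ^ (p - 1) * (r * v r ^ δ) ≤ r ^ (p - 1) * (n * (-deriv u r) ^ (p - 1)) := by gcongr
      _ = n * (r ^ (p - 1) * (-deriv u r) ^ (p - 1)) := by ring
      _ ≤ _ := by gcongr
  have h4 := mul_le_mul_of_nonneg_left h3 (Real.rpow_nonneg hr.le (α * (p - 1)))
  linarith

lemma radialFlux_le {n p α K B r : ℝ} {u : ℝ → ℝ} (hp : 1 < p) (hr : 0 < r)
    (hu : 0 < u r) (hneg : deriv u r < 0) (hK : logSlope u r ≤ K) (hB : r ^ α * u r ≤ B) :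
    radialFlux n p u r ≤ (K * B) ^ (p - 1) * r ^ (n - p - α * (p - 1)) := by
  have hU := neg_pos.2 hneg
  rw [logSlope, div_le_iff₀ hu] at hK
  have hK0 : 0 ≤ K := by
    have := mul_pos hr hU
    by_contra! h
    nlinarith
  have hα := Real.rpow_pos_of_pos hr α
  have h0 : r ^ α * (r * -deriv u r) ≤ K * B := by
    calc r ^ α * (r * -deriv u r) ≤ r ^ α * (K * u r) := by gcongr
      _ = K * (r ^ α * u r) := by ring
      _ ≤ _ := by gcongr
  have h1 := Real.rpow_le_rpow (mul_pos hα (mul_pos hr hU)).le h0 (show 0 ≤ p - 1 by linarith)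
  have h2 : radialFlux n p u r
      = (r ^ α * (r * -deriv u r)) ^ (p - 1) * r ^ (n - p - α * (p - 1)) := by
    have h3 : r ^ (n - 1) = r ^ (α * (p - 1)) * r ^ (p - 1) * r ^ (n - p - α * (p - 1)) := by
      rw [← Real.rpow_add hr, ← Real.rpow_add hr]
      ring_nf
    rw [Real.mul_rpow hα.le (mul_pos hr hU).le, Real.mul_rpow hr.le hU.le, ← Real.rpow_mul hr.le,
      radialFlux, h3]
    ring
  rw [h2]
  gcongr

lemma add_le_of_hyperbola {n p q M δ μ α β κ : ℝ} (hp : 2 ≤ p) (hpM : p ≤ M) (hqM : q ≤ M)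
    (hM : M < n) (hδ : 0 < δ) (hμ : 0 < μ) (hα : 0 < α) (hβ : 0 < β)
    (hαβ : α * (p - 1) + p = β * δ) (hβα : β * (q - 1) + q = α * μ)
    (hκ : κ = (n - M) / (M - 1)) (h : 1 / (δ + 1) + 1 / (μ + 1) ≤ κ / n) :
    α + β ≤ κ ∧ (2 < M → α + β < κ) := by
  have hM1 : 0 < M - 1 := by linarith
  have hn : n = κ * (M - 1) + M := by
    rw [hκ]
    field_simp
    ring
  have hn0 : 0 < n := by linarith
  set T := (α + β) * (M - 1) + M with hT
  have hT0 : 0 < T := by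
    have := mul_pos (add_pos hα hβ) hM1
    linarith
  have e1 : β * (δ + 1) ≤ T - β * (M - 2) := by nlinarith
  have e2 : α * (μ + 1) ≤ T := by nlinarith
  have i2 : α / T ≤ 1 / (μ + 1) := by
    rw [div_le_div_iff₀ hT0 (by linarith)]
    linarith
  have i1 : (β + β * (M - 2) * β / T) / T ≤ 1 / (δ + 1) := by
    rw [div_le_div_iff₀ hT0 (by linarith)]
    have h1 : β / T * (β * (δ + 1)) ≤ β := by
      rw [div_mul_eq_mul_div, div_le_iff₀ hT0]
      have : 0 ≤ β * (M - 2) := mul_nonneg hβ.le (by linarith)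
      nlinarith
    have h2 : β * (M - 2) * β / T * (δ + 1) = (M - 2) * (β / T * (β * (δ + 1))) := by ring
    have h3 := mul_le_mul_of_nonneg_left h1 (show 0 ≤ M - 2 by linarith)
    rw [add_mul, h2]
    linarith
  set x := β * (M - 2) * β / T with hx
  have hx0 : 0 ≤ x := div_nonneg (mul_nonneg (mul_nonneg hβ.le (by linarith)) hβ.le) hT0.le
  have i3 : (α + β + x) / T ≤ κ / n := by
    have : (α + β + x) / T = α / T + (β + x) / T := by ring
    linarith
  rw [div_le_div_iff₀ hT0 hn0] at i3
  have i4 : (α + β) * M + x * n ≤ κ * M := by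
    rw [hT] at i3
    have : (α + β) * n = (α + β) * (κ * (M - 1) + M) := by rw [← hn]
    nlinarith
  refine ⟨?_, fun hM2 => ?_⟩
  · have := mul_nonneg hx0 hn0.le
    exact le_of_mul_le_mul_right (by linarith) (show 0 < M by linarith)
  · have : 0 < x := div_pos (mul_pos (mul_pos hβ (by linarith)) hβ) hT0
    have := mul_pos this hn0
    exact lt_of_mul_lt_mul_right (by linarith) (show 0 ≤ M by linarith)

lemma hasDerivAt_scaled {n δ α β R T : ℝ} {u v : ℝ → ℝ} (hT : Real.exp T ≤ R)
    (hv : ∀ r ∈ Ioo 0 R, 0 < v r) (hneg : ∀ r ∈ Ioo 0 R, deriv u r < 0)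
    (heq : ∀ r ∈ Ioo 0 R, deriv (fun s => s ^ (n - 1) * |deriv u s| ^ ((2 : ℝ) - 2) * deriv u s) r
      = -(r ^ (n - 1) * v r ^ δ)) (hαβ : α + 2 = β * δ) (hn : n - 2 = α + β) :
    ∀ t < T,
      HasDerivAt (fun t => Real.exp (α * t) * u (Real.exp t))
        (Real.exp (α * t) * (α * u (Real.exp t) - Real.exp t * -deriv u (Real.exp t))) t ∧
      HasDerivAt
        (fun t => Real.exp (α * t) * (α * u (Real.exp t) - Real.exp t * -deriv u (Real.exp t)))
        ((α - β) * (Real.exp (α * t) * (α * u (Real.exp t) - Real.exp t * -deriv u (Real.exp t)))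
          + α * β * (Real.exp (α * t) * u (Real.exp t))
          - (Real.exp (β * t) * v (Real.exp t)) ^ δ) t := by
  intro t ht
  have hr : Real.exp t ∈ Ioo 0 R := ⟨Real.exp_pos _, (Real.exp_lt_exp.2 ht).trans_le hT⟩
  have hE : HasDerivAt (fun t => Real.exp (α * t)) (Real.exp (α * t) * α) t := by
    simpa using ((hasDerivAt_id t).const_mul α).exp
  have hu : HasDerivAt (fun t => u (Real.exp t)) (deriv u (Real.exp t) * Real.exp t) t :=
    ((differentiableAt_of_deriv_ne_zero (hneg _ hr).ne).hasDerivAt).comp t (Real.hasDerivAt_exp t)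
  have hU : HasDerivAt (fun t => -deriv u (Real.exp t)) _ t :=
    (hasDerivAt_neg_deriv one_lt_two hv hneg heq _ hr).comp t (Real.hasDerivAt_exp t)
  refine ⟨(hE.mul hu).congr_deriv (by ring), ?_⟩
  refine (hE.mul ((hu.const_mul α).sub ((Real.hasDerivAt_exp t).mul hU))).congr_deriv ?_
  have hne := neg_pos.2 (hneg _ hr)
  have hz : (Real.exp (β * t) * v (Real.exp t)) ^ δ
      = Real.exp (α * t) * Real.exp t ^ 2 * v (Real.exp t) ^ δ := by
    rw [Real.mul_rpow (Real.exp_pos _).le (hv _ hr).le, ← Real.exp_mul]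
    congr 1
    rw [← Real.exp_nat_mul, ← Real.exp_add]
    congr 1
    push_cast
    linear_combination (-t) * hαβ
  rw [hz, fluxRate, show (2 : ℝ) - 1 = 1 by norm_num, Real.rpow_one]
  have hn' : n = α + β + 2 := by linarith
  have := Real.exp_pos t
  simp only [Pi.mul_apply, Pi.sub_apply]
  rw [hn']
  generalize deriv u (Real.exp t) = d at *
  have : d ≠ 0 := by linarith
  field_simp
  ring

/-- Near the boundary the correction term of the Pohozaev-type functional is small. -/
lemma exists_inv_logSlope_lt {n q μ R K : ℝ} {u v : ℝ → ℝ} (hR : 0 < R) (hq : 1 < q) (hn : 1 < n)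
    (hv : ∀ r ∈ Ioo 0 R, 0 < v r) (hu : ∀ r ∈ Ioo 0 R, 0 < u r)
    (hneg : ∀ r ∈ Ioo 0 R, deriv v r < 0)
    (heq : ∀ r ∈ Ioo 0 R, deriv (fun s => s ^ (n - 1) * |deriv v s| ^ (q - 2) * deriv v s) r
      = -(r ^ (n - 1) * u r ^ μ))
    (hcont : ContinuousWithinAt v (Ioc 0 R) R) (hvR : v R = 0) (hK : 0 < K) :
    ∀ᶠ r in 𝓝[<] R, K < logSlope v r := by
  have hq1 : 0 < q - 1 := by linarith
  have hmono : MonotoneOn (radialFlux n q v) (Ioo 0 R) := by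
    refine monotoneOn_of_deriv_nonneg (convex_Ioo 0 R) (fun r hr =>
      (hasDerivAt_radialFlux hu hneg heq r hr).continuousAt.continuousWithinAt) ?_ ?_
    · intro r hr
      rw [interior_Ioo] at hr
      exact (hasDerivAt_radialFlux hu hneg heq r hr).differentiableAt.differentiableWithinAt
    · intro r hr
      rw [interior_Ioo] at hr
      rw [(hasDerivAt_radialFlux hu hneg heq r hr).deriv]
      have := radialFlux_pos (n := n) (p := q) hneg r hr
      have := fluxRate_pos (p := q) (δ := μ) hneg hu r hr
      have := hr.1
      positivity
  have hh : R / 2 ∈ Ioo 0 R := ⟨by linarith, by linarith⟩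
  set c := radialFlux n q v (R / 2) / R ^ (n - 1) with hc
  have hc0 : 0 < c := div_pos (radialFlux_pos hneg _ hh) (Real.rpow_pos_of_pos hR _)
  set d := c ^ (q - 1)⁻¹ with hd
  have hd0 : 0 < d := Real.rpow_pos_of_pos hc0 _
  have hVd : ∀ r ∈ Ioo (R / 2) R, d ≤ -deriv v r := by
    intro r hr
    have hrR : r ∈ Ioo 0 R := ⟨hh.1.trans hr.1, hr.2⟩
    have hV := neg_pos.2 (hneg r hrR)
    have h1 := hmono hh hrR hr.1.le
    have h2 : c ≤ (-deriv v r) ^ (q - 1) := by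
      rw [hc, div_le_iff₀ (Real.rpow_pos_of_pos hR _)]
      refine h1.trans ?_
      rw [radialFlux, mul_comm]
      have := Real.rpow_le_rpow hrR.1.le hr.2.le (show 0 ≤ n - 1 by linarith)
      gcongr
    have h3 := Real.rpow_le_rpow hc0.le h2 (inv_nonneg.2 hq1.le)
    rwa [Real.rpow_rpow_inv hV.le hq1.ne'] at h3
  have hlim : Tendsto v (𝓝[<] R) (𝓝 0) := by
    have h1 : Tendsto v (𝓝[Ioc 0 R] R) (𝓝 (v R)) := hcont
    rw [hvR] at h1
    refine h1.mono_left ?_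
    rw [← nhdsWithin_Ioo_eq_nhdsLT hR]
    exact nhdsWithin_mono _ Ioo_subset_Ioc_self
  have hε : 0 < R / 2 * d / K := by positivity
  filter_upwards [hlim.eventually (gt_mem_nhds hε), Ioo_mem_nhdsLT (half_lt_self hR)] with r h1 hr
  have hrR : r ∈ Ioo 0 R := ⟨hh.1.trans hr.1, hr.2⟩
  rw [logSlope, lt_div_iff₀ (hv r hrR)]
  rw [lt_div_iff₀ hK] at h1
  have := mul_le_mul hr.1.le (hVd r hr) hd0.le hrR.1.le
  linarith

/-- In the critical case the Pohozaev-type functional is the energy of the scaled system. -/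
lemma pohozaev_eq_energy {n δ μ α β t : ℝ} {u v : ℝ → ℝ} (hn : 0 < n) (hα : 0 < α) (hβ : 0 < β)
    (hαβ : α + 2 = β * δ) (hβα : β + 2 = α * μ) (hκ : n - 2 = α + β)
    (hu : 0 < u (Real.exp t)) (hv : 0 < v (Real.exp t))
    (hnu : deriv u (Real.exp t) < 0) (hnv : deriv v (Real.exp t) < 0) :
    Real.exp t ^ (-(α + β)) * (radialFlux n 2 u (Real.exp t) * radialFlux n 2 v (Real.exp t)) *
        (1 - (n - fluxRate 2 δ u v (Real.exp t)) / ((δ + 1) * logSlope v (Real.exp t))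
          - (n - fluxRate 2 μ v u (Real.exp t)) / ((μ + 1) * logSlope u (Real.exp t)))
      = Real.exp (α * t) * (α * u (Real.exp t) - Real.exp t * -deriv u (Real.exp t)) *
          (Real.exp (β * t) * (β * v (Real.exp t) - Real.exp t * -deriv v (Real.exp t)))
        - α * β * (Real.exp (α * t) * u (Real.exp t)) * (Real.exp (β * t) * v (Real.exp t))
        + Real.exp (β * t) * v (Real.exp t) * (Real.exp (β * t) * v (Real.exp t)) ^ δ / (δ + 1)
        + Real.exp (α * t) * u (Real.exp t) * (Real.exp (α * t) * u (Real.exp t)) ^ μ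
          / (μ + 1) := by
  have hz : (Real.exp (β * t) * v (Real.exp t)) ^ δ
      = Real.exp (α * t) * Real.exp t ^ 2 * v (Real.exp t) ^ δ := by
    rw [Real.mul_rpow (Real.exp_pos _).le hv.le, ← Real.exp_mul]
    congr 1
    rw [← Real.exp_nat_mul, ← Real.exp_add]
    congr 1
    push_cast
    linear_combination (-t) * hαβ
  have hw : (Real.exp (α * t) * u (Real.exp t)) ^ μ
      = Real.exp (β * t) * Real.exp t ^ 2 * u (Real.exp t) ^ μ := by
    rw [Real.mul_rpow (Real.exp_pos _).le hu.le, ← Real.exp_mul]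
    congr 1
    rw [← Real.exp_nat_mul, ← Real.exp_add]
    congr 1
    push_cast
    linear_combination (-t) * hβα
  have hpow : Real.exp t ^ (-(α + β)) * (Real.exp t ^ (n - 1) * Real.exp t ^ (n - 1))
      = Real.exp (α * t) * Real.exp (β * t) * Real.exp t ^ 2 := by
    rw [← Real.exp_mul, ← Real.exp_mul, ← Real.exp_nat_mul, ← Real.exp_add, ← Real.exp_add,
      ← Real.exp_add, ← Real.exp_add]
    congr 1
    push_cast
    linear_combination (2 * t) * hκ
  have hδ1 : δ + 1 = n / β := by
    rw [eq_div_iff hβ.ne']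
    linarith
  have hμ1 : μ + 1 = n / α := by
    rw [eq_div_iff hα.ne']
    linarith
  rw [hz, hw]
  simp only [radialFlux, fluxRate, logSlope, show (2 : ℝ) - 1 = 1 by norm_num, Real.rpow_one]
  have hr := Real.exp_pos t
  rw [mul_mul_mul_comm (Real.exp t ^ (n - 1)), ← mul_assoc (Real.exp t ^ (-(α + β))), hpow,
    hδ1, hμ1]
  have hU := neg_pos.2 hnu
  have hV := neg_pos.2 hnv
  generalize -deriv u (Real.exp t) = U at hU ⊢
  generalize -deriv v (Real.exp t) = V at hV ⊢
  clear hz hw hpow hnu hnv hδ1 hμ1 hαβ hβα hκ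
  generalize v (Real.exp t) ^ δ = f
  generalize u (Real.exp t) ^ μ = g
  generalize u (Real.exp t) = a at hu ⊢
  generalize v (Real.exp t) = b at hv ⊢
  generalize Real.exp t = r at hr ⊢
  field_simp
  ring

/-- Boundedness of the derivative of the scaled function. -/
lemma abs_deriv_scaled_le {β K B r : ℝ} {v : ℝ → ℝ} (hβ : 0 < β) (hK : 0 < K) (hr : 0 < r)
    (hv : 0 < v r) (hneg : deriv v r < 0) (hslope : logSlope v r ≤ K) (hB : r ^ β * v r ≤ B) :
    |r ^ β * (β * v r - r * -deriv v r)| ≤ (β + K) * B := by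
  rw [abs_mul, abs_of_pos (Real.rpow_pos_of_pos hr _)]
  rw [logSlope, div_le_iff₀ hv] at hslope
  have h2 : |β * v r - r * -deriv v r| ≤ (β + K) * v r := by
    have h3 := mul_pos hr (neg_pos.2 hneg)
    have h4 := mul_pos hβ hv
    have h5 := mul_pos hK hv
    rw [abs_le]
    constructor <;> linarith
  calc _ ≤ r ^ β * ((β + K) * v r) := mul_le_mul_of_nonneg_left h2 (Real.rpow_nonneg hr.le _)
    _ = (β + K) * (r ^ β * v r) := by ring
    _ ≤ _ := mul_le_mul_of_nonneg_left hB (by linarith)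

set_option maxHeartbeats 1000000 in
/-- Nonexistence of radial solutions, with the dimension allowed to be real. -/
theorem false_of_radial {n p q δ μ R : ℝ} {u v : ℝ → ℝ} (hR : 0 < R)
    (hδ : 0 < δ) (hμ : 0 < μ) (hD : 0 < δ * μ - (p - 1) * (q - 1))
    (hp : 2 ≤ p) (hpn : p < n) (hq : 2 ≤ q) (hqn : q < n)
    (hineq : 1 / (δ + 1) + 1 / (μ + 1) ≤ (n - max p q) / (n * (max p q - 1)))
    (hu : ∀ r ∈ Ioo 0 R, 0 < u r) (hv : ∀ r ∈ Ioo 0 R, 0 < v r)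
    (hdu : ∀ r ∈ Ioo 0 R, DifferentiableAt ℝ u r) (hdv : ∀ r ∈ Ioo 0 R, DifferentiableAt ℝ v r)
    (hcu : ContinuousWithinAt u (Ioc 0 R) R) (hcv : ContinuousWithinAt v (Ioc 0 R) R)
    (huR : u R = 0) (hvR : v R = 0)
    (equ : ∀ r ∈ Ioo 0 R, deriv (fun s => s ^ (n - 1) * |deriv u s| ^ (p - 2) * deriv u s) r
      = -(r ^ (n - 1) * v r ^ δ))
    (eqv : ∀ r ∈ Ioo 0 R, deriv (fun s => s ^ (n - 1) * |deriv v s| ^ (q - 2) * deriv v s) r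
      = -(r ^ (n - 1) * u r ^ μ)) : False := by
  have hp1 : 1 < p := by linarith
  have hq1 : 1 < q := by linarith
  have hn : 0 < n := by linarith
  have hnu := deriv_neg_of_radial hp1 hpn hu hv hdu equ
  have hnv := deriv_neg_of_radial hq1 hqn hv hu hdv eqv
  have hZn := fluxRate_le hn hδ hv hnu hnv equ
  have hWn := fluxRate_le hn hμ hu hnv hnu eqv
  set M := max p q with hM
  have hpM : p ≤ M := le_max_left _ _
  have hqM : q ≤ M := le_max_right _ _
  have hMn : M < n := max_lt hpn hqn
  set κ := (n - M) / (M - 1) with hκ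
  have hκ0 : 0 < κ := div_pos (by linarith) (by linarith)
  have hineq' : 1 / (δ + 1) + 1 / (μ + 1) ≤ κ / n := by
    rwa [hκ, div_div, mul_comm (M - 1)]
  have hκle : ∀ s, 2 ≤ s → s ≤ M → κ ≤ (n - s) / (s - 1) := by
    intro s hs hsM
    rw [hκ, div_le_div_iff₀ (by linarith) (by linarith)]
    nlinarith
  have hanti := antitoneOn_pohozaev hp hq hδ hμ (hκle p hp hpM) (hκle q hq hqM)
    (by rw [le_div_iff₀ hn] at hineq'; linarith)
    (hasDerivAt_logSlope hp1 hu hv hnu equ) (hasDerivAt_logSlope hq1 hv hu hnv eqv)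
    (hasDerivAt_fluxRate hv hnu hnv equ) (hasDerivAt_fluxRate hu hnv hnu eqv)
    (hasDerivAt_radialFlux hv hnu equ) (hasDerivAt_radialFlux hu hnv eqv)
    (logSlope_pos hnu hu) (logSlope_pos hnv hv) (fluxRate_pos hnu hv) (fluxRate_pos hnv hu)
    (radialFlux_pos hnu) (radialFlux_pos hnv) hZn hWn
  set Ψ : ℝ → ℝ := fun r => r ^ (-κ) * (radialFlux n p u r * radialFlux n q v r) *
      (1 - (n - fluxRate p δ u v r) / ((δ + 1) * logSlope v r)
        - (n - fluxRate q μ v u r) / ((μ + 1) * logSlope u r)) with hΨ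
  obtain ⟨r₁, hr₁, hΨ₁⟩ : ∃ r₁ ∈ Ioo 0 R, 0 < Ψ r₁ := by
    obtain ⟨r, ⟨h1, h2⟩, hr⟩ := ((exists_inv_logSlope_lt (K := 2 * n) hR hp1 (by linarith) hu hv
      hnu equ hcu huR (by linarith)).and (exists_inv_logSlope_lt (K := 2 * n) hR hq1 (by linarith)
      hv hu hnv eqv hcv hvR (by linarith)) |>.and (Ioo_mem_nhdsLT hR)).exists
    refine ⟨r, hr, mul_pos (mul_pos (Real.rpow_pos_of_pos hr.1 _)
      (mul_pos (radialFlux_pos hnu r hr) (radialFlux_pos hnv r hr))) ?_⟩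
    have h3 : (n - fluxRate p δ u v r) / ((δ + 1) * logSlope v r) < 1 / 2 := by
      rw [div_lt_iff₀ (mul_pos (by linarith) (by linarith))]
      have := fluxRate_pos (p := p) (δ := δ) hnu hv r hr
      nlinarith
    have h4 : (n - fluxRate q μ v u r) / ((μ + 1) * logSlope u r) < 1 / 2 := by
      rw [div_lt_iff₀ (mul_pos (by linarith) (by linarith))]
      have := fluxRate_pos (p := q) (δ := μ) hnv hu r hr
      nlinarith
    linarith
  set E := Ψ r₁ with hE
  have hsub : ∀ r ∈ Ioc 0 r₁, r ∈ Ioo 0 R := fun r hr => ⟨hr.1, hr.2.trans_lt hr₁.2⟩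
  have hEle : ∀ r ∈ Ioc 0 r₁, E ≤ Ψ r := fun r hr => hanti (hsub r hr) hr₁ hr.2
  have hEm : ∀ r ∈ Ioc 0 r₁, E ≤ r ^ (-κ) * (radialFlux n p u r * radialFlux n q v r) := by
    intro r hr
    have hrR := hsub r hr
    refine (hEle r hr).trans ?_
    rw [hΨ]
    refine mul_le_of_le_one_right (mul_nonneg (Real.rpow_nonneg hr.1.le _)
      (mul_pos (radialFlux_pos hnu r hrR) (radialFlux_pos hnv r hrR)).le) ?_
    have h3 : 0 ≤ (n - fluxRate p δ u v r) / ((δ + 1) * logSlope v r) :=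
      div_nonneg (by linarith [hZn r hrR]) (mul_pos (by linarith) (logSlope_pos hnv hv r hrR)).le
    have h4 : 0 ≤ (n - fluxRate q μ v u r) / ((μ + 1) * logSlope u r) :=
      div_nonneg (by linarith [hWn r hrR]) (mul_pos (by linarith) (logSlope_pos hnu hu r hrR)).le
    linarith
  have hK₁ := logSlope_le hp1 hu hv hnu equ hr₁
  have hK₂ := logSlope_le hq1 hv hu hnv eqv hr₁
  set K₁ := max ((n - p) / (p - 1)) (logSlope u r₁)
  set K₂ := max ((n - q) / (q - 1)) (logSlope v r₁)
  have hK₁0 : 0 < K₁ := (logSlope_pos hnu hu r₁ hr₁).trans_le (le_max_right _ _)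
  have hK₂0 : 0 < K₂ := (logSlope_pos hnv hv r₁ hr₁).trans_le (le_max_right _ _)
  set D := δ * μ - (p - 1) * (q - 1) with hDdef
  obtain ⟨α, hα⟩ : ∃ α, α = (p * (q - 1) + q * δ) / D := ⟨_, rfl⟩
  obtain ⟨β, hβ⟩ : ∃ β, β = (q * (p - 1) + p * μ) / D := ⟨_, rfl⟩
  have hα0 : 0 < α := by
    rw [hα]
    exact div_pos (add_pos (mul_pos (by linarith) (by linarith)) (mul_pos (by linarith) hδ)) hD
  have hβ0 : 0 < β := by
    rw [hβ]
    exact div_pos (add_pos (mul_pos (by linarith) (by linarith)) (mul_pos (by linarith) hμ)) hD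
  have hαβ : α * (p - 1) + p = β * δ := by
    rw [hα, hβ]
    field_simp
    rw [hDdef]
    ring
  have hβα : β * (q - 1) + q = α * μ := by
    rw [hα, hβ]
    field_simp
    rw [hDdef]
    ring
  have hS₁ : ∀ r ∈ Ioc 0 r₁, _ := fun r hr => scaled_rpow_le hp1 hr.1 (hu r (hsub r hr))
    (hv r (hsub r hr)) (hnu r (hsub r hr)) hαβ (hK₁ r hr) (hZn r (hsub r hr)) hn
  have hS₂ : ∀ r ∈ Ioc 0 r₁, _ := fun r hr => scaled_rpow_le hq1 hr.1 (hv r (hsub r hr))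
    (hu r (hsub r hr)) (hnv r (hsub r hr)) hβα (hK₂ r hr) (hWn r (hsub r hr)) hn
  have hw0 : ∀ r ∈ Ioc 0 r₁, 0 < r ^ α * u r := fun r hr =>
    mul_pos (Real.rpow_pos_of_pos hr.1 _) (hu r (hsub r hr))
  have hz0 : ∀ r ∈ Ioc 0 r₁, 0 < r ^ β * v r := fun r hr =>
    mul_pos (Real.rpow_pos_of_pos hr.1 _) (hv r (hsub r hr))
  have hC₁ : 0 < n * K₁ ^ (p - 1) := by positivity
  have hC₂ : 0 < n * K₂ ^ (q - 1) := by positivity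
  obtain ⟨B, hB0, hwB, hzB⟩ : ∃ B > 0, (∀ r ∈ Ioc 0 r₁, r ^ α * u r ≤ B) ∧
      ∀ r ∈ Ioc 0 r₁, r ^ β * v r ≤ B := by
    have hb₁ : ∀ r ∈ Ioc 0 r₁, _ := fun r hr => le_of_rpow_coupling (hw0 r hr) (hz0 r hr) hC₁ hC₂
      hδ (show 0 < q - 1 by linarith) hD (hS₁ r hr) (hS₂ r hr)
    have hb₂ : ∀ r ∈ Ioc 0 r₁, _ := fun r hr => le_of_rpow_coupling (hz0 r hr) (hw0 r hr) hC₂ hC₁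
      hμ (show 0 < p - 1 by linarith) (by rw [mul_comm μ, mul_comm (q - 1)]; exact hD)
      (hS₂ r hr) (hS₁ r hr)
    exact ⟨_, lt_max_of_lt_left ((hw0 r₁ ⟨hr₁.1, le_rfl⟩).trans_le (hb₁ r₁ ⟨hr₁.1, le_rfl⟩)),
      fun r hr => (hb₁ r hr).trans (le_max_left _ _),
      fun r hr => (hb₂ r hr).trans (le_max_right _ _)⟩
  obtain ⟨hσ, hσ'⟩ := add_le_of_hyperbola hp hpM hqM hMn hδ hμ hα0 hβ0 hαβ hβα hκ hineq'
  rcases hσ.lt_or_eq with hlt | heq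
  · -- subcritical growth of the scaled solution
    set e := (n - p - α * (p - 1)) + (n - q - β * (q - 1)) - κ with he
    have he0 : 0 < e := by
      have h1 := hκle p hp hpM
      have h2 := hκle q hq hqM
      rw [le_div_iff₀ (by linarith)] at h1 h2
      nlinarith
    set C := (K₁ * B) ^ (p - 1) * (K₂ * B) ^ (q - 1) with hC
    have hC0 : 0 < C := by positivity
    have hup : ∀ r ∈ Ioc 0 r₁, E ≤ C * r ^ e := by
      intro r hr
      have hrR := hsub r hr
      have h1 := radialFlux_le (n := n) hp1 hr.1 (hu r hrR) (hnu r hrR) (hK₁ r hr) (hwB r hr)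
      have h2 := radialFlux_le (n := n) hq1 hr.1 (hv r hrR) (hnv r hrR) (hK₂ r hr) (hzB r hr)
      have h3 := mul_le_mul h1 h2 (radialFlux_pos hnv r hrR).le
        (mul_nonneg (by positivity) (Real.rpow_nonneg hr.1.le _))
      refine (hEm r hr).trans ((mul_le_mul_of_nonneg_left h3
        (Real.rpow_nonneg hr.1.le (-κ))).trans_eq ?_)
      rw [he, hC, sub_eq_add_neg _ κ, Real.rpow_add hr.1, Real.rpow_add hr.1]
      ring
    have hlim : Tendsto (fun r : ℝ => C * r ^ e) (𝓝[>] 0) (𝓝 0) := by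
      have h1 := (Real.continuousAt_rpow_const 0 e (Or.inr he0.le)).tendsto.const_mul C
      rw [Real.zero_rpow he0.ne', mul_zero] at h1
      exact h1.mono_left nhdsWithin_le_nhds
    have := ge_of_tendsto hlim (by
      filter_upwards [Ioc_mem_nhdsGT hr₁.1] with r hr using hup r hr)
    linarith
  · -- the critical case, where the system is Hamiltonian
    have hM2 : M ≤ 2 := by
      by_contra! h
      exact (hσ' h).ne heq
    obtain rfl : p = 2 := le_antisymm (hpM.trans hM2) hp
    obtain rfl : q = 2 := le_antisymm (hqM.trans hM2) hq
    have hκn : n - 2 = α + β := by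
      rw [heq, hκ, le_antisymm hM2 hpM]
      norm_num
    have hαβ' : α + 2 = β * δ := by linarith
    have hβα' : β + 2 = α * μ := by linarith
    set T := Real.log r₁
    have hT : Real.exp T = r₁ := Real.exp_log hr₁.1
    have hexp : ∀ t < T, Real.exp t ∈ Ioc 0 r₁ := fun t ht =>
      ⟨Real.exp_pos _, hT ▸ (Real.exp_lt_exp.2 ht).le⟩
    have hmul : ∀ a t : ℝ, Real.exp (a * t) = Real.exp t ^ a := fun a t => by
      rw [mul_comm, Real.exp_mul]
    have hdw := hasDerivAt_scaled (hT.trans_le hr₁.2.le) hv hnu equ hαβ' hκn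
    have hdz := hasDerivAt_scaled (hT.trans_le hr₁.2.le) hu hnv eqv hβα' (by linarith)
    refine false_of_energy_pos (T := T) (γ := α - β) (B := max B ((β + K₂) * B)) (k := α * β)
      (mul_pos hα0 hβ0) hδ hμ (by linarith) hΨ₁ (fun t ht => (hdw t ht).1)
      (fun t ht => (hdz t ht).1) (fun t ht => (hdw t ht).2)
      (fun t ht => (hdz t ht).2.congr_deriv (by ring)) ?_ ?_ ?_ ?_ ?_ ?_
    · intro t ht
      rw [hmul]
      exact hw0 _ (hexp t ht)
    · intro t ht
      rw [hmul]
      exact hz0 _ (hexp t ht)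
    · intro t ht
      rw [hmul]
      exact (hwB _ (hexp t ht)).trans (le_max_left _ _)
    · intro t ht
      rw [hmul]
      exact (hzB _ (hexp t ht)).trans (le_max_left _ _)
    · intro t ht
      refine le_trans ?_ (le_max_right _ _)
      have hr := hexp t ht
      have hrR := hsub _ hr
      rw [hmul]
      exact abs_deriv_scaled_le hβ0 hK₂0 hr.1 (hv _ hrR) (hnv _ hrR) (hK₂ _ hr) (hzB _ hr)
    · intro t ht
      have hr := hexp t ht
      have hrR := hsub _ hr
      refine (hEle _ hr).trans_eq ?_
      rw [hΨ, ← heq]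
      exact pohozaev_eq_energy hn hα0 hβ0 hαβ' hβα' hκn (hu _ hrR) (hv _ hrR) (hnu _ hrR)
        (hnv _ hrR)

/-- Theorem 1.6(1): nonexistence of radial solutions (regular or not) to (S_R),
superquadratic case. -/
theorem nonexistence_superquadratic (N : ℕ) (hN : 2 < N) (p q δ μ : ℝ)
    (hδ : 0 < δ) (hμ : 0 < μ) (hH1 : 0 < δ * μ - (p - 1) * (q - 1))
    (hp1 : 2 ≤ p) (hp2 : p < (N : ℝ)) (hq1 : 2 ≤ q) (hq2 : q < (N : ℝ))
    (hineq : 1 / (δ + 1) + 1 / (μ + 1) ≤ ((N : ℝ) - max p q) / (N * (max p q - 1))) :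
    ∀ R : ℝ, 0 < R → ¬ ∃ u v : ℝ → ℝ, IsRadialSolutionAux N p q δ μ R u v := by
  rintro R hR ⟨u, v, hcu, hcv, -, -, hu, hv, huR, hvR, equ, eqv⟩
  have hdiff : ∀ f : ℝ → ℝ, ContDiffOn ℝ 1 f (Ioc 0 R) →
      ∀ r ∈ Ioo 0 R, DifferentiableAt ℝ f r := fun f hf r hr =>
    (hf.differentiableOn one_ne_zero).differentiableAt (Ioc_mem_nhds hr.1 hr.2)
  exact false_of_radial hR hδ hμ hH1 hp1 hp2 hq1 hq2 hineq hu hv (hdiff u hcu) (hdiff v hcv)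
    (hcu.continuousOn R ⟨hR, le_rfl⟩) (hcv.continuousOn R ⟨hR, le_rfl⟩) huR hvR equ eqv
end

section
/- Let N ≥ 2 be an integer, p, q > 1 and δ, μ > 0 satisfy condition (H₁). If there exists no radial ground state, i.e. no pair (u,v) of real functions on [0,∞), continuously differentiable on [0,∞) and twice continuously differentiable on (0,∞), with u(r) > 0 and v(r) > 0 for all r ≥ 0, u'(0) = v'(0) = 0, satisfying for all r > 0: (r^{N−1}|u'(r)|^{p−2}u'(r))' = −r^{N−1} v(r)^δ and (r^{N−1}|v'(r)|^{q−2}v'(r))' = −r^{N−1} u(r)^μ, then for every R > 0 the system (S_R) possesses a regular radial solution (u,v). -/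
/-- A regular radial solution of system (S_R) on the ball of radius `R`. -/
def IsRadialSolution (N : ℕ) (p q δ μ R : ℝ) (u v : ℝ → ℝ) : Prop :=
  ContDiffOn ℝ 1 u (Set.Icc 0 R) ∧ ContDiffOn ℝ 1 v (Set.Icc 0 R) ∧
  ContDiffOn ℝ 2 u (Set.Ioc 0 R) ∧ ContDiffOn ℝ 2 v (Set.Ioc 0 R) ∧
  (∀ r ∈ Set.Ico (0:ℝ) R, 0 < u r) ∧ (∀ r ∈ Set.Ico (0:ℝ) R, 0 < v r) ∧
  deriv u 0 = 0 ∧ deriv v 0 = 0 ∧ u R = 0 ∧ v R = 0 ∧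
  (∀ r ∈ Set.Ioc (0:ℝ) R,
    deriv (fun s => s ^ ((N:ℝ) - 1) * |deriv u s| ^ (p - 2) * deriv u s) r
      = -(r ^ ((N:ℝ) - 1) * v r ^ δ)) ∧
  (∀ r ∈ Set.Ioc (0:ℝ) R,
    deriv (fun s => s ^ ((N:ℝ) - 1) * |deriv v s| ^ (q - 2) * deriv v s) r
      = -(r ^ ((N:ℝ) - 1) * u r ^ μ))

/-- A radial ground state of system (S_∞) on `[0,∞)`. -/
def IsGroundState (N : ℕ) (p q δ μ : ℝ) (u v : ℝ → ℝ) : Prop :=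
  ContDiffOn ℝ 1 u (Set.Ici 0) ∧ ContDiffOn ℝ 1 v (Set.Ici 0) ∧
  ContDiffOn ℝ 2 u (Set.Ioi 0) ∧ ContDiffOn ℝ 2 v (Set.Ioi 0) ∧
  (∀ r : ℝ, 0 ≤ r → 0 < u r) ∧ (∀ r : ℝ, 0 ≤ r → 0 < v r) ∧
  deriv u 0 = 0 ∧ deriv v 0 = 0 ∧
  (∀ r : ℝ, 0 < r →
    deriv (fun s => s ^ ((N:ℝ) - 1) * |deriv u s| ^ (p - 2) * deriv u s) r
      = -(r ^ ((N:ℝ) - 1) * v r ^ δ)) ∧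
  (∀ r : ℝ, 0 < r →
    deriv (fun s => s ^ ((N:ℝ) - 1) * |deriv v s| ^ (q - 2) * deriv v s) r
      = -(r ^ ((N:ℝ) - 1) * u r ^ μ))

open Set Filter Topology

noncomputable section

/-- The spherical mean `s⁻ᴺ ∫₀ˢ tᴺ⁻¹ (f t)₊^δ dt`, in a form which is regular at `s = 0`. -/
def radialMean (N : ℕ) (δ : ℝ) (f : ℝ → ℝ) (s : ℝ) : ℝ :=
  ∫ τ in (0:ℝ)..1, τ ^ (N - 1) * (max (f (s * τ)) 0) ^ δ

/-- The absolute value of the derivative of the radial solution `w` of `-Δ_p w = f₊^δ`. -/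
def radialSlope (N : ℕ) (p δ : ℝ) (f : ℝ → ℝ) (s : ℝ) : ℝ :=
  (max s 0 * radialMean N δ f s) ^ (1 / (p - 1))

/-- The solution operator of `Δ_p w = f₊^δ`, `w 0 = 0`, for radial functions. -/
def radialSolve (N : ℕ) (p δ : ℝ) (f : ℝ → ℝ) (r : ℝ) : ℝ :=
  ∫ s in (0:ℝ)..r, radialSlope N p δ f s

section Continuity

variable {X : Type*} [TopologicalSpace X]

theorem continuous_radialMean_param (N : ℕ) {δ : ℝ} (hδ : 0 < δ) {F : X → ℝ → ℝ}
    (hF : Continuous F.uncurry) :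
    Continuous fun x : X × ℝ => radialMean N δ (F x.1) x.2 := by
  unfold radialMean
  refine intervalIntegral.continuous_parametric_intervalIntegral_of_continuous' ?_ 0 1
  have h : Continuous fun y : (X × ℝ) × ℝ => F y.1.1 (y.1.2 * y.2) :=
    hF.comp (by fun_prop : Continuous fun y : (X × ℝ) × ℝ => (y.1.1, y.1.2 * y.2))
  exact (by fun_prop : Continuous fun y : (X × ℝ) × ℝ => y.2 ^ (N - 1)).mul
    ((h.max continuous_const).rpow_const fun _ => Or.inr hδ.le)

theorem continuous_radialSlope_param (N : ℕ) {p δ : ℝ} (hp : 1 < p) (hδ : 0 < δ) {F : X → ℝ → ℝ}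
    (hF : Continuous F.uncurry) :
    Continuous fun x : X × ℝ => radialSlope N p δ (F x.1) x.2 := by
  unfold radialSlope
  refine (((continuous_snd.max continuous_const).mul
    (continuous_radialMean_param N hδ hF))).rpow_const fun _ => Or.inr ?_
  have : 0 < p - 1 := by linarith
  positivity

theorem continuous_radialSolve_param (N : ℕ) {p δ : ℝ} (hp : 1 < p) (hδ : 0 < δ) {F : X → ℝ → ℝ}
    (hF : Continuous F.uncurry) :
    Continuous fun x : X × ℝ => radialSolve N p δ (F x.1) x.2 :=
  intervalIntegral.continuous_parametric_primitive_of_continuous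
    (f := fun x s => radialSlope N p δ (F x) s) (continuous_radialSlope_param N hp hδ hF)

end Continuity

section Basic

variable {N : ℕ} {p δ : ℝ} {f : ℝ → ℝ}

theorem continuous_radialMean (hδ : 0 < δ) (hf : Continuous f) :
    Continuous (radialMean N δ f) :=
  (continuous_radialMean_param N hδ (F := fun _ : Unit => f) (by fun_prop)).comp
    (by fun_prop : Continuous fun r : ℝ => ((), r))

theorem continuous_radialSlope (hp : 1 < p) (hδ : 0 < δ) (hf : Continuous f) :
    Continuous (radialSlope N p δ f) :=
  (continuous_radialSlope_param N hp hδ (F := fun _ : Unit => f) (by fun_prop)).comp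
    (by fun_prop : Continuous fun r : ℝ => ((), r))

theorem hasDerivAt_radialSolve (hp : 1 < p) (hδ : 0 < δ) (hf : Continuous f) (r : ℝ) :
    HasDerivAt (radialSolve N p δ f) (radialSlope N p δ f r) r :=
  ((continuous_radialSlope hp hδ hf).integral_hasStrictDerivAt 0 r).hasDerivAt

theorem continuous_radialSolve (hp : 1 < p) (hδ : 0 < δ) (hf : Continuous f) :
    Continuous (radialSolve N p δ f) :=
  continuous_iff_continuousAt.2 fun r => (hasDerivAt_radialSolve hp hδ hf r).continuousAt

theorem radialMean_nonneg (s : ℝ) : 0 ≤ radialMean N δ f s :=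
  intervalIntegral.integral_nonneg zero_le_one fun _ hτ =>
    mul_nonneg (pow_nonneg hτ.1 _) (Real.rpow_nonneg (le_max_right _ _) _)

theorem radialSlope_nonneg (s : ℝ) : 0 ≤ radialSlope N p δ f s :=
  Real.rpow_nonneg (mul_nonneg (le_max_right _ _) (radialMean_nonneg s)) _

theorem radialSlope_of_nonpos (hp : 1 < p) {s : ℝ} (hs : s ≤ 0) :
    radialSlope N p δ f s = 0 := by
  have : p - 1 ≠ 0 := by linarith
  simp [radialSlope, max_eq_right hs, this]

theorem radialSolve_of_nonpos (hp : 1 < p) {r : ℝ} (hr : r ≤ 0) :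
    radialSolve N p δ f r = 0 := by
  refine (intervalIntegral.integral_congr (g := fun _ => 0) fun s hs => ?_).trans (by simp)
  rw [uIcc_of_ge hr] at hs
  exact radialSlope_of_nonpos hp hs.2

theorem monotone_radialSolve (hp : 1 < p) (hδ : 0 < δ) (hf : Continuous f) :
    Monotone (radialSolve N p δ f) :=
  monotone_of_deriv_nonneg (fun r => (hasDerivAt_radialSolve hp hδ hf r).differentiableAt)
    fun r => (hasDerivAt_radialSolve hp hδ hf r).deriv ▸ radialSlope_nonneg r

theorem radialMean_pos (hδ : 0 < δ) (hf : Continuous f) (h0 : 0 < f 0) (s : ℝ) :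
    0 < radialMean N δ f s := by
  have hc : Continuous fun τ : ℝ => f (s * τ) := by fun_prop
  have hev : ∀ᶠ τ in 𝓝[>] (0:ℝ), 0 < f (s * τ) :=
    (hc.tendsto' 0 (f 0) (by simp)).eventually_const_lt h0 |>.filter_mono nhdsWithin_le_nhds
  obtain ⟨τ, h1, h2⟩ := (hev.and (Ioc_mem_nhdsGT zero_lt_one)).exists
  refine intervalIntegral.integral_pos zero_lt_one ?_ ?_ ⟨τ, ⟨h2.1.le, h2.2⟩, ?_⟩
  · exact ((continuous_pow _).mul ((hc.max continuous_const).rpow_const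
      fun _ => Or.inr hδ.le)).continuousOn
  · exact fun τ hτ => mul_nonneg (pow_nonneg hτ.1.le _) (Real.rpow_nonneg (le_max_right _ _) _)
  · exact mul_pos (pow_pos h2.1 _) (Real.rpow_pos_of_pos (lt_max_of_lt_left h1) _)

theorem radialSlope_pos (hδ : 0 < δ) (hf : Continuous f) (h0 : 0 < f 0) {s : ℝ} (hs : 0 < s) :
    0 < radialSlope N p δ f s :=
  Real.rpow_pos_of_pos (mul_pos (lt_max_of_lt_left hs) (radialMean_pos hδ hf h0 s)) _

theorem strictMonoOn_radialSolve (hp : 1 < p) (hδ : 0 < δ) (hf : Continuous f) (h0 : 0 < f 0) :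
    StrictMonoOn (radialSolve N p δ f) (Ici 0) := by
  refine strictMonoOn_of_deriv_pos (convex_Ici 0) (continuous_radialSolve hp hδ hf).continuousOn ?_
  intro s hs
  rw [interior_Ici] at hs
  rw [(hasDerivAt_radialSolve hp hδ hf s).deriv]
  exact radialSlope_pos hδ hf h0 hs

theorem radialMean_le_one (hδ : 0 < δ) (hf : Continuous f) (h1 : ∀ x, f x ≤ 1) (s : ℝ) :
    radialMean N δ f s ≤ 1 := by
  have hc : Continuous fun τ : ℝ => τ ^ (N - 1) * (max (f (s * τ)) 0) ^ δ :=
    (continuous_pow _).mul (((hf.comp (continuous_const_mul s)).max continuous_const).rpow_const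
      fun _ => Or.inr hδ.le)
  have := intervalIntegral.integral_mono_on zero_le_one (hc.intervalIntegrable 0 1)
    (intervalIntegrable_const (c := (1:ℝ)) (μ := MeasureTheory.volume)) fun τ hτ =>
    mul_le_one₀ (pow_le_one₀ hτ.1 hτ.2) (Real.rpow_nonneg (le_max_right _ _) _)
      (Real.rpow_le_one (le_max_right _ _) (max_le (h1 _) zero_le_one) hδ.le)
  simpa [radialMean] using this

theorem radialMean_congr {g : ℝ → ℝ} {s T : ℝ} (h : ∀ x ≤ T, f x = g x) (hs0 : 0 ≤ s)
    (hs : s ≤ T) : radialMean N δ f s = radialMean N δ g s := by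
  refine intervalIntegral.integral_congr fun τ hτ => ?_
  rw [uIcc_of_le zero_le_one] at hτ
  have : s * τ ≤ T := (mul_le_of_le_one_right hs0 hτ.2).trans hs
  simp only [h _ this]

theorem radialSolve_congr (hp : 1 < p) {g : ℝ → ℝ} {r T : ℝ} (h : ∀ x ≤ T, f x = g x)
    (hr : r ≤ T) : radialSolve N p δ f r = radialSolve N p δ g r := by
  rcases le_total r 0 with h0 | h0
  · rw [radialSolve_of_nonpos hp h0, radialSolve_of_nonpos hp h0]
  refine intervalIntegral.integral_congr fun s hs => ?_
  rw [uIcc_of_le h0] at hs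
  simp only [radialSlope, radialMean_congr h hs.1 (hs.2.trans hr)]

/-- A primitive of the largest possible slope for a source bounded by one. -/
def radialBound (p r : ℝ) : ℝ := ∫ s in (0:ℝ)..r, (max s 0) ^ (1 / (p - 1))

theorem continuous_radialBound_integrand (hp : 1 < p) :
    Continuous fun s : ℝ => (max s 0) ^ (1 / (p - 1)) := by
  have : 0 < p - 1 := by linarith
  exact (continuous_id.max continuous_const).rpow_const fun _ => Or.inr (by positivity)

theorem continuous_radialBound (hp : 1 < p) : Continuous (radialBound p) :=
  continuous_iff_continuousAt.2 fun r =>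
    ((continuous_radialBound_integrand hp).integral_hasStrictDerivAt 0 r).hasDerivAt.continuousAt

theorem abs_radialSolve_sub_le (hp : 1 < p) (hδ : 0 < δ) (hf : Continuous f)
    (h1 : ∀ x, f x ≤ 1) (r s : ℝ) :
    |radialSolve N p δ f r - radialSolve N p δ f s| ≤ |radialBound p r - radialBound p s| := by
  have hi := continuous_radialSlope (N := N) hp hδ hf
  have hb := continuous_radialBound_integrand hp
  rw [radialSolve, radialSolve, radialBound, radialBound,
    intervalIntegral.integral_interval_sub_left (hi.intervalIntegrable _ _)
      (hi.intervalIntegrable _ _),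
    intervalIntegral.integral_interval_sub_left (hb.intervalIntegrable _ _)
      (hb.intervalIntegrable _ _)]
  refine intervalIntegral.norm_integral_le_abs_of_norm_le (E := ℝ)
    (μ := MeasureTheory.volume) (Eventually.of_forall fun t => ?_) (hb.intervalIntegrable _ _)
  rw [Real.norm_eq_abs, abs_of_nonneg (radialSlope_nonneg t)]
  have : 0 < p - 1 := by linarith
  exact Real.rpow_le_rpow (mul_nonneg (le_max_right _ _) (radialMean_nonneg t))
    (mul_le_of_le_one_right (le_max_right _ _) (radialMean_le_one hδ hf h1 t)) (by positivity)

end Basic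

section Regularity

variable {N : ℕ} {p δ a : ℝ} {f w : ℝ → ℝ}

theorem continuous_radialSource (N : ℕ) (hδ : 0 < δ) (hf : Continuous f) :
    Continuous fun t : ℝ => t ^ (N - 1) * (max (f t) 0) ^ δ :=
  (continuous_pow _).mul ((hf.max continuous_const).rpow_const fun _ => Or.inr hδ.le)

theorem pow_mul_radialMean (hN : 1 ≤ N) (s : ℝ) :
    s ^ N * radialMean N δ f s = ∫ t in (0:ℝ)..s, t ^ (N - 1) * (max (f t) 0) ^ δ := by
  have h := intervalIntegral.smul_integral_comp_mul_left (a := 0) (b := 1)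
    (fun t : ℝ => t ^ (N - 1) * (max (f t) 0) ^ δ) s
  rw [mul_zero, mul_one] at h
  rw [← h, radialMean, smul_eq_mul, ← Nat.sub_add_cancel hN, pow_succ', mul_assoc,
    Nat.add_sub_cancel]
  congr 1
  rw [← intervalIntegral.integral_const_mul]
  simp only [mul_pow, mul_assoc]

theorem hasDerivAt_of_eq_sub_radialSolve (hp : 1 < p) (hδ : 0 < δ) (hf : Continuous f)
    (hw : ∀ r, w r = a - radialSolve N p δ f r) (r : ℝ) :
    HasDerivAt w (-radialSlope N p δ f r) r := by
  rw [funext hw]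
  exact (hasDerivAt_radialSolve hp hδ hf r).const_sub a

theorem deriv_of_eq_sub_radialSolve (hp : 1 < p) (hδ : 0 < δ) (hf : Continuous f)
    (hw : ∀ r, w r = a - radialSolve N p δ f r) :
    deriv w = fun r => -radialSlope N p δ f r :=
  funext fun r => (hasDerivAt_of_eq_sub_radialSolve hp hδ hf hw r).deriv

theorem contDiff_of_eq_sub_radialSolve (hp : 1 < p) (hδ : 0 < δ) (hf : Continuous f)
    (hw : ∀ r, w r = a - radialSolve N p δ f r) : ContDiff ℝ 1 w := by
  refine contDiff_one_iff_deriv.2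
    ⟨fun r => (hasDerivAt_of_eq_sub_radialSolve hp hδ hf hw r).differentiableAt, ?_⟩
  rw [deriv_of_eq_sub_radialSolve hp hδ hf hw]
  exact (continuous_radialSlope hp hδ hf).neg

theorem contDiffOn_of_eq_sub_radialSolve (hN : 1 ≤ N) (hp : 1 < p) (hδ : 0 < δ)
    (hf : Continuous f) (h0 : 0 < f 0) (hw : ∀ r, w r = a - radialSolve N p δ f r) :
    ContDiffOn ℝ 2 w (Ioi 0) := by
  have hW : ContDiff ℝ 1 fun s => ∫ t in (0:ℝ)..s, t ^ (N - 1) * (max (f t) 0) ^ δ := by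
    have hc := continuous_radialSource N hδ hf
    refine contDiff_one_iff_deriv.2
      ⟨fun r => (hc.integral_hasStrictDerivAt 0 r).hasDerivAt.differentiableAt, ?_⟩
    rw [funext fun r => (hc.integral_hasStrictDerivAt 0 r).hasDerivAt.deriv]
    exact hc
  have hbase : ContDiffOn ℝ 1
      (fun s => s * ((∫ t in (0:ℝ)..s, t ^ (N - 1) * (max (f t) 0) ^ δ) / s ^ N)) (Ioi 0) :=
    contDiffOn_id.mul (hW.contDiffOn.div (contDiff_id.pow N).contDiffOn
      fun _ hs => (pow_pos hs N).ne')
  have heq : EqOn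
      (fun s => s * ((∫ t in (0:ℝ)..s, t ^ (N - 1) * (max (f t) 0) ^ δ) / s ^ N))
      (fun s => s * radialMean N δ f s) (Ioi 0) := by
    intro s (hs : 0 < s)
    simp only
    rw [← pow_mul_radialMean hN s, mul_div_cancel_left₀ _ (pow_pos hs N).ne']
  have hslope : ContDiffOn ℝ 1 (radialSlope N p δ f) (Ioi 0) := by
    refine (((hbase.congr fun _ hs => (heq hs).symm).rpow_const_of_ne (p := 1 / (p - 1))
      fun _ hs => (mul_pos hs (radialMean_pos hδ hf h0 _)).ne')).congr fun s hs => ?_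
    rw [radialSlope, max_eq_left (le_of_lt hs)]
  have h2 : (2 : WithTop ℕ∞) = 1 + 1 := by norm_num
  rw [h2, contDiffOn_succ_iff_deriv_of_isOpen isOpen_Ioi]
  refine ⟨fun s _ =>
    (hasDerivAt_of_eq_sub_radialSolve hp hδ hf hw s).differentiableAt.differentiableWithinAt,
    by simp, ?_⟩
  rw [deriv_of_eq_sub_radialSolve hp hδ hf hw]
  exact hslope.neg

theorem deriv_flux_of_eq_sub_radialSolve (hN : 1 ≤ N) (hp : 1 < p) (hδ : 0 < δ)
    (hf : Continuous f) (hw : ∀ r, w r = a - radialSolve N p δ f r) {r : ℝ} (hr : 0 < r) :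
    deriv (fun s => s ^ ((N:ℝ) - 1) * |deriv w s| ^ (p - 2) * deriv w s) r
      = -(r ^ ((N:ℝ) - 1) * (max (f r) 0) ^ δ) := by
  have hp1 : 0 < p - 1 := by linarith
  have hpow : ∀ s : ℝ, s ^ ((N:ℝ) - 1) = s ^ (N - 1) := fun s => by
    rw [← Real.rpow_natCast, Nat.cast_sub hN, Nat.cast_one]
  have heq : (fun s => s ^ ((N:ℝ) - 1) * |deriv w s| ^ (p - 2) * deriv w s) =ᶠ[𝓝 r]
      fun s => -∫ t in (0:ℝ)..s, t ^ (N - 1) * (max (f t) 0) ^ δ := by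
    filter_upwards [Ioi_mem_nhds hr] with s hs
    have hA := radialMean_nonneg (N := N) (δ := δ) (f := f) s
    have hS := radialSlope_nonneg (N := N) (p := p) (δ := δ) (f := f) s
    have hflux : radialSlope N p δ f s ^ (p - 2) * radialSlope N p δ f s
        = s * radialMean N δ f s := by
      have h1 : radialSlope N p δ f s ^ (p - 1) = s * radialMean N δ f s := by
        rw [radialSlope, max_eq_left (le_of_lt hs), ← Real.rpow_mul (mul_nonneg (le_of_lt hs) hA),
          one_div, inv_mul_cancel₀ hp1.ne', Real.rpow_one]
      rw [← h1]
      rcases hS.eq_or_lt with h | h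
      · rw [← h, mul_zero, Real.zero_rpow hp1.ne']
      · rw [← Real.rpow_add_one h.ne']
        congr 1
        ring
    rw [deriv_of_eq_sub_radialSolve hp hδ hf hw, hpow, ← pow_mul_radialMean hN s]
    simp only [abs_neg, abs_of_nonneg hS]
    rw [mul_neg, mul_assoc, hflux, ← mul_assoc, ← pow_succ, Nat.sub_add_cancel hN]
  rw [heq.deriv_eq, hpow]
  exact ((continuous_radialSource N hδ hf).integral_hasStrictDerivAt 0 r).hasDerivAt.neg.deriv

end Regularity

section System

variable {N : ℕ} {p q δ μ a b : ℝ} {u v : ℝ → ℝ}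

theorem strictAntiOn_of_eq_sub_radialSolve {f w : ℝ → ℝ} (hp : 1 < p) (hδ : 0 < δ)
    (hf : Continuous f) (h0 : 0 < f 0) (hw : ∀ r, w r = a - radialSolve N p δ f r) :
    StrictAntiOn w (Ici 0) := fun x hx y hy hxy => by
  rw [hw, hw]
  exact sub_lt_sub_left (strictMonoOn_radialSolve hp hδ hf h0 hx hy hxy) a

theorem eq_at_zero_of_eq_sub_radialSolve {f w : ℝ → ℝ} (hp : 1 < p)
    (hw : ∀ r, w r = a - radialSolve N p δ f r) : w 0 = a := by
  rw [hw, radialSolve_of_nonpos hp le_rfl, sub_zero]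

theorem isGroundState_of_eq_sub_radialSolve (hN : 1 ≤ N) (hp : 1 < p) (hq : 1 < q) (hδ : 0 < δ)
    (hμ : 0 < μ) (hu : Continuous u) (hv : Continuous v)
    (hu' : ∀ r, u r = a - radialSolve N p δ v r) (hv' : ∀ r, v r = b - radialSolve N q μ u r)
    (hupos : ∀ r, 0 ≤ r → 0 < u r) (hvpos : ∀ r, 0 ≤ r → 0 < v r) :
    IsGroundState N p q δ μ u v := by
  refine ⟨(contDiff_of_eq_sub_radialSolve hp hδ hv hu').contDiffOn,
    (contDiff_of_eq_sub_radialSolve hq hμ hu hv').contDiffOn,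
    contDiffOn_of_eq_sub_radialSolve hN hp hδ hv (hvpos 0 le_rfl) hu',
    contDiffOn_of_eq_sub_radialSolve hN hq hμ hu (hupos 0 le_rfl) hv', hupos, hvpos, ?_, ?_,
    fun r hr => ?_, fun r hr => ?_⟩
  · simp [deriv_of_eq_sub_radialSolve hp hδ hv hu', radialSlope_of_nonpos hp le_rfl]
  · simp [deriv_of_eq_sub_radialSolve hq hμ hu hv', radialSlope_of_nonpos hq le_rfl]
  · rw [deriv_flux_of_eq_sub_radialSolve hN hp hδ hv hu' hr, max_eq_left (hvpos r hr.le).le]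
  · rw [deriv_flux_of_eq_sub_radialSolve hN hq hμ hu hv' hr, max_eq_left (hupos r hr.le).le]

theorem isRadialSolution_of_eq_sub_radialSolve (hN : 1 ≤ N) (hp : 1 < p) (hq : 1 < q)
    (hδ : 0 < δ) (hμ : 0 < μ) (hu : Continuous u) (hv : Continuous v)
    (hu' : ∀ r, u r = a - radialSolve N p δ v r) (hv' : ∀ r, v r = b - radialSolve N q μ u r)
    (ha : 0 < a) (hb : 0 < b) {R : ℝ} (hR : 0 < R) (huR : u R = 0) (hvR : v R = 0) :
    IsRadialSolution N p q δ μ R u v := by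
  have hu0 : 0 < u 0 := (eq_at_zero_of_eq_sub_radialSolve hp hu').symm ▸ ha
  have hv0 : 0 < v 0 := (eq_at_zero_of_eq_sub_radialSolve hq hv').symm ▸ hb
  have hupos : ∀ r ∈ Ico (0:ℝ) R, 0 < u r := fun r hr =>
    huR ▸ strictAntiOn_of_eq_sub_radialSolve hp hδ hv hv0 hu' hr.1 hR.le hr.2
  have hvpos : ∀ r ∈ Ico (0:ℝ) R, 0 < v r := fun r hr =>
    hvR ▸ strictAntiOn_of_eq_sub_radialSolve hq hμ hu hu0 hv' hr.1 hR.le hr.2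
  have hnn : ∀ {w : ℝ → ℝ}, (∀ r ∈ Ico (0:ℝ) R, 0 < w r) → w R = 0 →
      ∀ r ∈ Ioc (0:ℝ) R, 0 ≤ w r := fun hw hwR r hr => by
    rcases hr.2.eq_or_lt with h | h
    · rw [h, hwR]
    · exact (hw r ⟨hr.1.le, h⟩).le
  refine ⟨(contDiff_of_eq_sub_radialSolve hp hδ hv hu').contDiffOn,
    (contDiff_of_eq_sub_radialSolve hq hμ hu hv').contDiffOn,
    (contDiffOn_of_eq_sub_radialSolve hN hp hδ hv hv0 hu').mono Ioc_subset_Ioi_self,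
    (contDiffOn_of_eq_sub_radialSolve hN hq hμ hu hu0 hv').mono Ioc_subset_Ioi_self,
    hupos, hvpos, ?_, ?_, huR, hvR, fun r hr => ?_, fun r hr => ?_⟩
  · simp [deriv_of_eq_sub_radialSolve hp hδ hv hu', radialSlope_of_nonpos hp le_rfl]
  · simp [deriv_of_eq_sub_radialSolve hq hμ hu hv', radialSlope_of_nonpos hq le_rfl]
  · rw [deriv_flux_of_eq_sub_radialSolve hN hp hδ hv hu' hr.1, max_eq_left (hnn hvpos hvR r hr)]
  · rw [deriv_flux_of_eq_sub_radialSolve hN hq hμ hu hv' hr.1, max_eq_left (hnn hupos huR r hr)]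

theorem radialSolve_comp_mul {f : ℝ → ℝ} (hp : 1 < p) {c d lam : ℝ} (hc : 0 ≤ c)
    (hd : 0 ≤ d) (hlam : 0 < lam) (hcd : c ^ (p - 1) * lam ^ p = d ^ δ) (r : ℝ) :
    radialSolve N p δ (fun s => d * f (lam * s)) r = c * radialSolve N p δ f (lam * r) := by
  have hp1 : 0 < p - 1 := by linarith
  have hmean : ∀ s, radialMean N δ (fun s => d * f (lam * s)) s
      = d ^ δ * radialMean N δ f (lam * s) := fun s => by
    rw [radialMean, radialMean, ← intervalIntegral.integral_const_mul]
    congr 1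
    ext τ
    rw [← mul_zero d, ← mul_max_of_nonneg _ _ hd, mul_zero,
      Real.mul_rpow hd (le_max_right _ _), mul_assoc lam]
    ring
  have hslope : ∀ s, radialSlope N p δ (fun s => d * f (lam * s)) s
      = c * (lam * radialSlope N p δ f (lam * s)) := fun s => by
    have hkey : (c * lam) = (c ^ (p - 1) * lam ^ (p - 1)) ^ (1 / (p - 1)) := by
      rw [← Real.mul_rpow hc hlam.le, ← Real.rpow_mul (mul_nonneg hc hlam.le),
        mul_one_div_cancel hp1.ne', Real.rpow_one]
    rw [← mul_assoc, hkey, radialSlope, radialSlope, ← Real.mul_rpow (by positivity)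
      (mul_nonneg (le_max_right _ _) (radialMean_nonneg _)), hmean, ← hcd,
      Real.rpow_sub_one hlam.ne', ← mul_zero lam, ← mul_max_of_nonneg _ _ hlam.le, mul_zero]
    congr 1
    field_simp
  have h := intervalIntegral.smul_integral_comp_mul_left (a := 0) (b := r)
    (radialSlope N p δ f) lam
  rw [mul_zero, smul_eq_mul] at h
  simp only [radialSolve, hslope, intervalIntegral.integral_const_mul]
  rw [h]

theorem exists_isRadialSolution_of_eq_sub_radialSolve (hN : 1 ≤ N) (hp : 1 < p) (hq : 1 < q)
    (hδ : 0 < δ) (hμ : 0 < μ) (hH : 0 < δ * μ - (p - 1) * (q - 1)) (hu : Continuous u)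
    (hv : Continuous v) (hu' : ∀ r, u r = a - radialSolve N p δ v r)
    (hv' : ∀ r, v r = b - radialSolve N q μ u r) (ha : 0 < a) (hb : 0 < b) {ρ : ℝ} (hρ : 0 < ρ)
    (huρ : u ρ = 0) (hvρ : v ρ = 0) {R : ℝ} (hR : 0 < R) :
    ∃ u v : ℝ → ℝ, IsRadialSolution N p q δ μ R u v := by
  set lam := ρ / R
  have hlam : 0 < lam := div_pos hρ hR
  set α := (p * (q - 1) + q * δ) / (δ * μ - (p - 1) * (q - 1)) with hα
  set β := (q * (p - 1) + p * μ) / (δ * μ - (p - 1) * (q - 1)) with hβ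
  have h1 : α * (p - 1) + p = β * δ := by
    rw [hα, hβ, div_mul_eq_mul_div, div_mul_eq_mul_div, div_add' _ _ _ hH.ne',
      div_left_inj' hH.ne']
    ring
  have h2 : β * (q - 1) + q = α * μ := by
    rw [hα, hβ, div_mul_eq_mul_div, div_mul_eq_mul_div, div_add' _ _ _ hH.ne',
      div_left_inj' hH.ne']
    ring
  have hcd : (lam ^ α) ^ (p - 1) * lam ^ p = (lam ^ β) ^ δ := by
    rw [← Real.rpow_mul hlam.le, ← Real.rpow_mul hlam.le, ← Real.rpow_add hlam, h1]
  have hdc : (lam ^ β) ^ (q - 1) * lam ^ q = (lam ^ α) ^ μ := by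
    rw [← Real.rpow_mul hlam.le, ← Real.rpow_mul hlam.le, ← Real.rpow_add hlam, h2]
  have hc : 0 < lam ^ α := Real.rpow_pos_of_pos hlam _
  have hd : 0 < lam ^ β := Real.rpow_pos_of_pos hlam _
  have hlR : lam * R = ρ := div_mul_cancel₀ ρ hR.ne'
  refine ⟨fun r => lam ^ α * u (lam * r), fun r => lam ^ β * v (lam * r),
    isRadialSolution_of_eq_sub_radialSolve (a := lam ^ α * a) (b := lam ^ β * b) hN hp hq hδ hμ
      (by fun_prop) (by fun_prop) (fun r => ?_) (fun r => ?_) (mul_pos hc ha) (mul_pos hd hb) hR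
      (by simp [hlR, huρ]) (by simp [hlR, hvρ])⟩
  · rw [radialSolve_comp_mul hp hc.le hd.le hlam hcd, hu', mul_sub]
  · rw [radialSolve_comp_mul hq hd.le hc.le hlam hdc, hv', mul_sub]

end System

section Approximation

/-- The solution operator acting on continuous functions. -/
def radialSolveMap (N : ℕ) {p δ : ℝ} (hp : 1 < p) (hδ : 0 < δ) (f : C(ℝ, ℝ)) : C(ℝ, ℝ) :=
  ⟨radialSolve N p δ f, continuous_radialSolve hp hδ f.continuous⟩

theorem continuous_radialSolveMap (N : ℕ) {p δ : ℝ} (hp : 1 < p) (hδ : 0 < δ) :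
    Continuous (radialSolveMap N hp hδ) :=
  ContinuousMap.continuous_of_continuous_uncurry _ <|
    continuous_radialSolve_param N hp hδ (F := fun (f : C(ℝ, ℝ)) x => f x) (by fun_prop)

/-- Translation of a function to the right by `ε`. -/
def delay (ε : ℝ) (f : C(ℝ, ℝ)) : C(ℝ, ℝ) := f.comp ⟨fun r => r - ε, by fun_prop⟩

theorem delay_apply (ε : ℝ) (f : C(ℝ, ℝ)) (r : ℝ) : delay ε f r = f (r - ε) := rfl

theorem continuous_delay : Continuous fun x : ℝ × C(ℝ, ℝ) => delay x.1 x.2 :=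
  ContinuousMap.continuous_of_continuous_uncurry _ <| by
    simp only [Function.uncurry_def, delay_apply]
    fun_prop

/-- Continuous functions vanishing at the origin with the modulus of continuity of `P`. -/
def modulusBall (P : ℝ → ℝ) : Set C(ℝ, ℝ) :=
  {f | f 0 = 0 ∧ ∀ r s, |f r - f s| ≤ |P r - P s|}

theorem isCompact_modulusBall {P : ℝ → ℝ} (hP : Continuous P) : IsCompact (modulusBall P) := by
  have key : ∀ x : ℝ, Tendsto (fun y => |P x - P y|) (𝓝 x) (𝓝 0) := fun x =>
    (by fun_prop : Continuous fun y => |P x - P y|).tendsto' x 0 (by simp)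
  refine ArzelaAscoli.isCompact_of_equicontinuous _ ?_ ?_
  · have himg : ContinuousMap.toFun '' modulusBall P
        = {f : ℝ → ℝ | f 0 = 0 ∧ ∀ r s, |f r - f s| ≤ |P r - P s|} := by
      ext f
      refine ⟨?_, fun hf => ⟨⟨f, continuous_iff_continuousAt.2 fun x => ?_⟩, hf, rfl⟩⟩
      · rintro ⟨g, hg, rfl⟩
        exact hg
      · refine tendsto_iff_dist_tendsto_zero.2 (squeeze_zero (fun _ => dist_nonneg)
          (fun y => ?_) (key x))
        rw [dist_comm, Real.dist_eq]
        exact hf.2 x y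
    rw [himg]
    have hclosed : IsClosed {f : ℝ → ℝ | f 0 = 0 ∧ ∀ r s, |f r - f s| ≤ |P r - P s|} := by
      simp only [ofPred_and, ofPred_forall]
      refine (isClosed_eq (by fun_prop) (by fun_prop)).inter
        (isClosed_iInter fun r => isClosed_iInter fun s => isClosed_le (by fun_prop) (by fun_prop))
    refine (isCompact_univ_pi fun r : ℝ => isCompact_Icc (a := -|P r - P 0|)
      (b := |P r - P 0|)).of_isClosed_subset hclosed fun f hf r _ => abs_le.1 ?_
    simpa [hf.1] using hf.2 r 0
  · intro x
    refine Metric.equicontinuousAt_of_continuity_modulus _ (key x) _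
      (Eventually.of_forall fun y f => ?_)
    rw [Real.dist_eq]
    exact f.2.2 x y

/-- Solutions of the delayed system with data `t` and `1 - t`, valid up to radius `T`, and
depending continuously on `t`. -/
structure IsDelayedFamily (N : ℕ) {p q δ μ : ℝ} (hp : 1 < p) (hq : 1 < q) (hδ : 0 < δ)
    (hμ : 0 < μ) (ε T : ℝ) (U V : ℝ → C(ℝ, ℝ)) : Prop where
  continuous_left : Continuous U
  continuous_right : Continuous V
  antitone_left : ∀ t, Antitone (U t)
  antitone_right : ∀ t, Antitone (V t)
  left_of_nonpos : ∀ t, ∀ r ≤ 0, U t r = t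
  right_of_nonpos : ∀ t, ∀ r ≤ 0, V t r = 1 - t
  left_eq : ∀ t, ∀ r ≤ T, U t r = t - radialSolveMap N hp hδ (delay ε (V t)) r
  right_eq : ∀ t, ∀ r ≤ T, V t r = 1 - t - radialSolveMap N hq hμ (delay ε (U t)) r
  left_mem : ∀ t ∈ Icc (0:ℝ) 1, .const ℝ t - U t ∈ modulusBall (radialBound p)
  right_mem : ∀ t ∈ Icc (0:ℝ) 1, .const ℝ (1 - t) - V t ∈ modulusBall (radialBound q)

variable (N : ℕ) {p q δ μ : ℝ} (hp : 1 < p) (hq : 1 < q) (hδ : 0 < δ) (hμ : 0 < μ)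

theorem radialSolveMap_mem_modulusBall {f : C(ℝ, ℝ)} (hf : ∀ x, f x ≤ 1) :
    radialSolveMap N hp hδ f ∈ modulusBall (radialBound p) :=
  ⟨radialSolve_of_nonpos hp le_rfl, abs_radialSolve_sub_le hp hδ f.continuous hf⟩

theorem le_of_antitone_of_eq {f : ℝ → ℝ} (hf : Antitone f) {c : ℝ} (h : ∀ r ≤ 0, f r = c)
    (x : ℝ) : f x ≤ c :=
  (hf (min_le_left x 0)).trans_eq (h _ (min_le_right x 0))

theorem exists_isDelayedFamily_nat (ε : ℝ) (k : ℕ) :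
    ∃ U V, IsDelayedFamily N hp hq hδ hμ ε (k * ε) U V := by
  induction k with
  | zero =>
    refine ⟨fun t => .const ℝ t, fun t => .const ℝ (1 - t), by fun_prop, by fun_prop,
      fun _ => antitone_const, fun _ => antitone_const, fun _ _ _ => rfl, fun _ _ _ => rfl,
      fun t r hr => ?_, fun t r hr => ?_, fun t _ => ?_, fun t _ => ?_⟩
    · have : radialSolveMap N hp hδ (delay ε (.const ℝ (1 - t))) r = 0 :=
        radialSolve_of_nonpos hp (by simpa using hr)
      simp [this]
    · have : radialSolveMap N hq hμ (delay ε (.const ℝ t)) r = 0 :=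
        radialSolve_of_nonpos hq (by simpa using hr)
      simp [this]
    · simp [modulusBall]
    · simp [modulusBall]
  | succ k ih =>
    obtain ⟨U, V, h⟩ := ih
    have hU1 := fun t => le_of_antitone_of_eq (h.antitone_left t) (h.left_of_nonpos t)
    have hV1 := fun t => le_of_antitone_of_eq (h.antitone_right t) (h.right_of_nonpos t)
    refine ⟨fun t => .const ℝ t - radialSolveMap N hp hδ (delay ε (V t)),
      fun t => .const ℝ (1 - t) - radialSolveMap N hq hμ (delay ε (U t)), ?_, ?_,
      fun t x y hxy => ?_, fun t x y hxy => ?_, fun t r hr => ?_, fun t r hr => ?_,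
      fun t r hr => ?_, fun t r hr => ?_, fun t ht => ?_, fun t ht => ?_⟩
    · have := (continuous_radialSolveMap N hp hδ).comp
        (continuous_delay.comp (continuous_const (y := ε) |>.prodMk h.continuous_right))
      exact (by fun_prop : Continuous fun t : ℝ => ContinuousMap.const ℝ t).sub this
    · have := (continuous_radialSolveMap N hq hμ).comp
        (continuous_delay.comp (continuous_const (y := ε) |>.prodMk h.continuous_left))
      exact (by fun_prop : Continuous fun t : ℝ => ContinuousMap.const ℝ (1 - t)).sub this
    · exact sub_le_sub_left (monotone_radialSolve hp hδ (delay ε (V t)).continuous hxy) t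
    · exact sub_le_sub_left (monotone_radialSolve hq hμ (delay ε (U t)).continuous hxy) (1 - t)
    · exact sub_eq_self.2 (radialSolve_of_nonpos hp hr)
    · exact sub_eq_self.2 (radialSolve_of_nonpos hq hr)
    · refine congrArg (t - ·) (radialSolve_congr hp (T := r) (fun x hx => ?_) le_rfl)
      have hx' : x - ε ≤ k * ε := by
        push_cast at hr
        linarith
      exact h.right_eq t _ hx'
    · refine congrArg (1 - t - ·) (radialSolve_congr hq (T := r) (fun x hx => ?_) le_rfl)
      have hx' : x - ε ≤ k * ε := by
        push_cast at hr
        linarith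
      exact h.left_eq t _ hx'
    · rw [sub_sub_cancel]
      exact radialSolveMap_mem_modulusBall N hp hδ fun x =>
        (hV1 t _).trans (by linarith [ht.1])
    · rw [sub_sub_cancel]
      exact radialSolveMap_mem_modulusBall N hq hμ fun x => (hU1 t _).trans ht.2

theorem IsDelayedFamily.mono {N : ℕ} {hp : 1 < p} {hq : 1 < q} {hδ : 0 < δ} {hμ : 0 < μ}
    {ε T T' : ℝ} {U V : ℝ → C(ℝ, ℝ)} (h : IsDelayedFamily N hp hq hδ hμ ε T U V) (hT : T' ≤ T) :
    IsDelayedFamily N hp hq hδ hμ ε T' U V :=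
  { h with
    left_eq := fun t r hr => h.left_eq t r (hr.trans hT)
    right_eq := fun t r hr => h.right_eq t r (hr.trans hT) }

theorem exists_isDelayedFamily {ε : ℝ} (hε : 0 < ε) (T : ℝ) :
    ∃ U V, IsDelayedFamily N hp hq hδ hμ ε T U V := by
  obtain ⟨k, hk⟩ := exists_nat_ge (T / ε)
  obtain ⟨U, V, h⟩ := exists_isDelayedFamily_nat N hp hq hδ hμ ε k
  exact ⟨U, V, h.mono ((div_le_iff₀ hε).1 hk)⟩

/-- Either some pair of the family is nonnegative on `[0, T]`, or some pair has a common zero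
in `[0, T]`. -/
theorem exists_nonneg_or_common_zero {U V : ℝ → C(ℝ, ℝ)} (hU : Continuous U) (hV : Continuous V)
    (hUa : ∀ t, Antitone (U t)) (hVa : ∀ t, Antitone (V t)) (hU0 : ∀ t, U t 0 = t)
    (hV0 : ∀ t, V t 0 = 1 - t) {T : ℝ} (hT : 0 ≤ T) :
    ∃ t ∈ Icc (0:ℝ) 1, ∃ r ∈ Icc 0 T, 0 ≤ U t r ∧ 0 ≤ V t r ∧
      (r = T ∨ U t r = 0 ∧ V t r = 0) := by
  by_contra! hcon
  have hclosed : ∀ {F G : ℝ → C(ℝ, ℝ)}, Continuous F → Continuous G →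
      IsClosed {t : ℝ | ∃ r ∈ Icc 0 T, F t r = 0 ∧ 0 ≤ G t r} := fun {F G} hF hG => by
    have hFc : Continuous fun x : Icc 0 T × ℝ => F x.2 x.1 := by fun_prop
    have hGc : Continuous fun x : Icc 0 T × ℝ => G x.2 x.1 := by fun_prop
    have hc : IsClosed {x : Icc 0 T × ℝ | F x.2 x.1 = 0 ∧ 0 ≤ G x.2 x.1} :=
      (isClosed_eq hFc continuous_const).inter (isClosed_le continuous_const hGc)
    convert isClosedMap_snd_of_compactSpace _ hc using 1
    ext t
    constructor
    · rintro ⟨r, hr, h⟩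
      exact ⟨(⟨r, hr⟩, t), h, rfl⟩
    · rintro ⟨⟨r, t'⟩, h, rfl⟩
      exact ⟨r, r.2, h⟩
  have h0T : (0:ℝ) ∈ Icc 0 T := ⟨le_rfl, hT⟩
  have hcover : Icc (0:ℝ) 1 ⊆ {t | ∃ r ∈ Icc 0 T, U t r = 0 ∧ 0 ≤ V t r} ∪
      {t | ∃ r ∈ Icc 0 T, V t r = 0 ∧ 0 ≤ U t r} := fun t ht => by
    have hcont : Continuous fun r => min (U t r) (V t r) := by fun_prop
    have hTneg : min (U t T) (V t T) ≤ 0 := by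
      by_contra! hpos
      rw [lt_min_iff] at hpos
      exact (hcon t ht T ⟨hT, le_rfl⟩ hpos.1.le hpos.2.le).1 rfl
    have h0pos : 0 ≤ min (U t 0) (V t 0) := by
      rw [hU0, hV0]
      exact le_min ht.1 (by linarith [ht.2])
    obtain ⟨r, hr, hr0⟩ := intermediate_value_Icc' hT hcont.continuousOn ⟨hTneg, h0pos⟩
    simp only at hr0
    rcases min_choice (U t r) (V t r) with h | h
    · exact Or.inl ⟨r, hr, h ▸ hr0, hr0 ▸ min_le_right _ _⟩
    · exact Or.inr ⟨r, hr, h ▸ hr0, hr0 ▸ min_le_left _ _⟩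
  obtain ⟨t, ht, ⟨r₁, hr₁, hu₁, hv₁⟩, r₂, hr₂, hv₂, hu₂⟩ :=
    isPreconnected_closed_iff.1 (isPreconnected_Icc (a := (0:ℝ)) (b := 1)) _ _ (hclosed hU hV)
      (hclosed hV hU) hcover
      ⟨0, ⟨le_rfl, zero_le_one⟩, 0, h0T, by simp [hU0], by simp [hV0]⟩
      ⟨1, ⟨zero_le_one, le_rfl⟩, 0, h0T, by simp [hV0], by simp [hU0]⟩
  rcases le_total r₁ r₂ with h | h
  · have : U t r₂ = 0 := le_antisymm (hu₁ ▸ hUa t h) hu₂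
    exact (hcon t ht r₂ hr₂ hu₂ hv₂.ge).2 this hv₂
  · have : V t r₁ = 0 := le_antisymm (hv₂ ▸ hVa t h) hv₁
    exact (hcon t ht r₁ hr₁ hu₁.ge hv₁).2 hu₁ this

end Approximation

/-- The truncated integral system with data `t` and `1 - t` has, for some `t`, a solution which is
either nonnegative on `[0, ∞)` or has a common zero before which it is nonnegative. -/
theorem exists_solution_nonneg_or_common_zero (N : ℕ) {p q δ μ : ℝ} (hp : 1 < p) (hq : 1 < q)
    (hδ : 0 < δ) (hμ : 0 < μ) :
    ∃ t ∈ Icc (0:ℝ) 1, ∃ u v : C(ℝ, ℝ), (∀ r, u r = t - radialSolve N p δ v r) ∧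
      (∀ r, v r = 1 - t - radialSolve N q μ u r) ∧
      ((∀ r, 0 ≤ u r ∧ 0 ≤ v r) ∨ ∃ r, 0 ≤ r ∧ u r = 0 ∧ v r = 0) := by
  have hε : ∀ n : ℕ, 0 < 1 / ((n:ℝ) + 1) := fun n => by positivity
  choose U V hUV using fun n : ℕ => exists_isDelayedFamily N hp hq hδ hμ (hε n) n
  choose t ht r hr hu hv hor using fun n : ℕ =>
    exists_nonneg_or_common_zero (hUV n).continuous_left (hUV n).continuous_right
      (hUV n).antitone_left (hUV n).antitone_right (fun t => (hUV n).left_of_nonpos t 0 le_rfl)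
      (fun t => (hUV n).right_of_nonpos t 0 le_rfl) n.cast_nonneg
  set 𝒰 : Ultrafilter ℕ := hyperfilter ℕ with h𝒰
  have h𝒰top : (𝒰 : Filter ℕ) ≤ atTop := by
    rw [h𝒰, ← Nat.cofinite_eq_atTop]
    exact hyperfilter_le_cofinite
  have lim : ∀ {X : Type} [TopologicalSpace X] {K : Set X} (_ : IsCompact K) {x : ℕ → X},
      (∀ᶠ n in (𝒰 : Filter ℕ), x n ∈ K) → ∃ y ∈ K, Tendsto x 𝒰 (𝓝 y) := fun hK x hx =>
    hK.ultrafilter_le_nhds' (𝒰.map x) hx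
  obtain ⟨s, hs, hts⟩ := lim isCompact_Icc (Eventually.of_forall ht)
  obtain ⟨f, -, hf⟩ := lim (isCompact_modulusBall (continuous_radialBound hp))
    (Eventually.of_forall fun n => (hUV n).left_mem (t n) (ht n))
  obtain ⟨g, -, hg⟩ := lim (isCompact_modulusBall (continuous_radialBound hq))
    (Eventually.of_forall fun n => (hUV n).right_mem (t n) (ht n))
  have hconst : Continuous fun c : ℝ => ContinuousMap.const ℝ c := by fun_prop
  obtain ⟨u, hulim⟩ : ∃ u, Tendsto (fun n => U n (t n)) 𝒰 (𝓝 u) :=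
    ⟨_, by simpa using ((hconst.tendsto s).comp hts).sub hf⟩
  obtain ⟨v, hvlim⟩ : ∃ v, Tendsto (fun n => V n (t n)) 𝒰 (𝓝 v) :=
    ⟨_, by simpa using ((hconst.tendsto (1 - s)).comp (hts.const_sub 1)).sub hg⟩
  have heps : Tendsto (fun n : ℕ => 1 / ((n:ℝ) + 1)) 𝒰 (𝓝 0) :=
    tendsto_one_div_add_atTop_nhds_zero_nat.mono_left h𝒰top
  have heval : ∀ {F : ℕ → C(ℝ, ℝ)} {f : C(ℝ, ℝ)} {x : ℕ → ℝ} {y : ℝ}, Tendsto F 𝒰 (𝓝 f) →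
      Tendsto x 𝒰 (𝓝 y) → Tendsto (fun n => F n (x n)) 𝒰 (𝓝 (f y)) := fun hF hx =>
    ((by fun_prop : Continuous fun z : C(ℝ, ℝ) × ℝ => z.1 z.2).tendsto _).comp (hF.prodMk_nhds hx)
  have hdelay : ∀ {F : ℕ → C(ℝ, ℝ)} {f : C(ℝ, ℝ)}, Tendsto F 𝒰 (𝓝 f) →
      Tendsto (fun n : ℕ => delay (1 / ((n:ℝ) + 1)) (F n)) 𝒰 (𝓝 f) := fun {F f} hF => by
    have := (continuous_delay.tendsto ((0:ℝ), f)).comp (heps.prodMk_nhds hF)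
    have h0 : delay 0 f = f := by
      ext r
      simp [delay_apply]
    rwa [h0] at this
  have hge : ∀ x : ℝ, ∀ᶠ n : ℕ in (𝒰 : Filter ℕ), x ≤ n := fun x =>
    h𝒰top (tendsto_natCast_atTop_atTop.eventually_ge_atTop x)
  refine ⟨s, hs, u, v, fun x => ?_, fun x => ?_, ?_⟩
  · refine tendsto_nhds_unique (heval hulim tendsto_const_nhds) ((hts.sub (heval
      (((continuous_radialSolveMap N hp hδ).tendsto v).comp (hdelay hvlim))
        (tendsto_const_nhds (x := x)))).congr' ?_)
    filter_upwards [hge x] with n hn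
    exact ((hUV n).left_eq (t n) x hn).symm
  · refine tendsto_nhds_unique (heval hvlim tendsto_const_nhds) (((hts.const_sub 1).sub (heval
      (((continuous_radialSolveMap N hq hμ).tendsto u).comp (hdelay hulim))
        (tendsto_const_nhds (x := x)))).congr' ?_)
    filter_upwards [hge x] with n hn
    exact ((hUV n).right_eq (t n) x hn).symm
  · by_cases hbdd : ∃ M, ∀ᶠ n in (𝒰 : Filter ℕ), r n ≤ M
    · obtain ⟨M, hM⟩ := hbdd
      obtain ⟨ρ, hρ, hrρ⟩ := lim (isCompact_Icc (a := 0) (b := M))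
        (hM.mono fun n hn => ⟨(hr n).1, hn⟩)
      have hzero : ∀ᶠ n in (𝒰 : Filter ℕ), U n (t n) (r n) = 0 ∧ V n (t n) (r n) = 0 := by
        filter_upwards [hM, hge (M + 1)] with n h1 h2
        exact (hor n).resolve_left (by linarith)
      refine Or.inr ⟨ρ, hρ.1, ?_, ?_⟩
      · exact tendsto_nhds_unique ((heval hulim hrρ).congr' (hzero.mono fun n h => h.1))
          tendsto_const_nhds
      · exact tendsto_nhds_unique ((heval hvlim hrρ).congr' (hzero.mono fun n h => h.2))
          tendsto_const_nhds
    · push Not at hbdd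
      have hlarge : ∀ x, ∀ᶠ n in (𝒰 : Filter ℕ), x ≤ r n := fun x =>
        (hbdd x).mono fun n h => h.le
      refine Or.inl fun x => ⟨ge_of_tendsto (heval hulim (tendsto_const_nhds (x := x))) ?_,
        ge_of_tendsto (heval hvlim (tendsto_const_nhds (x := x))) ?_⟩
      · filter_upwards [hlarge x] with n hn
        exact (hu n).trans ((hUV n).antitone_left (t n) hn)
      · filter_upwards [hlarge x] with n hn
        exact (hv n).trans ((hUV n).antitone_right (t n) hn)

end

/-- Proposition 1.1: if (S_∞) has no radial ground state, then (S_R) has a regular radial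
solution for every `R > 0`. -/
theorem existence_of_no_groundstate (N : ℕ) (hN : 2 ≤ N) (p q δ μ : ℝ)
    (hp : 1 < p) (hq : 1 < q) (hδ : 0 < δ) (hμ : 0 < μ)
    (hH1 : 0 < δ * μ - (p - 1) * (q - 1))
    (hno : ¬ ∃ u v : ℝ → ℝ, IsGroundState N p q δ μ u v) :
    ∀ R : ℝ, 0 < R → ∃ u v : ℝ → ℝ, IsRadialSolution N p q δ μ R u v := by
  intro R hR
  have hN1 : 1 ≤ N := by omega
  obtain ⟨t, ht, u, v, hu, hv, h⟩ := exists_solution_nonneg_or_common_zero N hp hq hδ hμ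
  have hu0 : u 0 = t := eq_at_zero_of_eq_sub_radialSolve hp hu
  have hv0 : v 0 = 1 - t := eq_at_zero_of_eq_sub_radialSolve hq hv
  have hanti : 0 < v 0 → StrictAntiOn u (Set.Ici 0) := fun h0 =>
    strictAntiOn_of_eq_sub_radialSolve hp hδ v.continuous h0 hu
  have hanti' : 0 < u 0 → StrictAntiOn v (Set.Ici 0) := fun h0 =>
    strictAntiOn_of_eq_sub_radialSolve hq hμ u.continuous h0 hv
  have hpos : ∀ {w : ℝ → ℝ}, StrictAntiOn w (Set.Ici 0) → (∀ r, 0 ≤ w r) → ∀ r, 0 ≤ r → 0 < w r :=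
    fun hw hnn r hr => (hnn (r + 1)).trans_lt
      (hw hr (by simp only [Set.mem_Ici]; linarith) (lt_add_one r))
  rcases h with h | ⟨ρ, hρ, huρ, hvρ⟩
  · have hut : 0 < u 0 := by
      by_contra! hle
      have : 0 < v 0 := by linarith
      exact absurd (hpos (hanti this) (fun r => (h r).1) 0 le_rfl) hle.not_gt
    have hvt : 0 < v 0 := by
      by_contra! hle
      exact absurd (hpos (hanti' hut) (fun r => (h r).2) 0 le_rfl) hle.not_gt
    exact absurd ⟨u, v, isGroundState_of_eq_sub_radialSolve hN1 hp hq hδ hμ u.continuous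
      v.continuous hu hv (hpos (hanti hvt) fun r => (h r).1)
      (hpos (hanti' hut) fun r => (h r).2)⟩ hno
  · have hρ0 : 0 < ρ := hρ.lt_of_ne fun h0 => by
      rw [← h0] at huρ hvρ
      linarith
    have hut : 0 < u 0 := by
      by_contra! hle
      have hlt := hanti (by linarith) (Set.self_mem_Ici) hρ hρ0
      linarith
    have hvt : 0 < v 0 := by
      by_contra! hle
      have hlt := hanti' hut (Set.self_mem_Ici) hρ hρ0
      linarith
    exact exists_isRadialSolution_of_eq_sub_radialSolve hN1 hp hq hδ hμ hH1 u.continuous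
      v.continuous hu hv (hu0 ▸ hut) (hv0 ▸ hvt) hρ0 huρ hvρ hR
end

section
/- Let N ≥ 2 be an integer, δ, μ > 0, and suppose either 2N/(N+1) ≤ p ≤ q ≤ 2 or 2 ≤ p ≤ q < N; set k₁ = p + (N−p)(p−2)/(p−1) in the first case and k₁ = q/(q−1) in the second case. Let (u,v) be a pair of real functions on [0,∞), continuously differentiable on [0,∞), twice continuously differentiable on (0,∞), with u, v > 0 on [0,∞), satisfying for all r > 0: (r^{N−1}|u'(r)|^{p−2}u'(r))' = −r^{N−1} v(r)^δ and (r^{N−1}|v'(r)|^{q−2}v'(r))' = −r^{N−1} u(r)^μ, and assume that s ↦ s^{k₁−2}|u'(s)|^{p−1} and s ↦ s^{k₁−2}|v'(s)|^{q−1} are (improperly) integrable on (1,∞). Define for r > 0: E₁(r) = r^{N+k₁−2}|u'(r)|^{p−1}|v'(r)|^{q−1} − (N/(δ+1)) r^{N−1}|u'(r)|^{p−1} ∫_r^∞ s^{k₁−2}|v'(s)|^{q−1} ds − (N/(μ+1)) r^{N−1}|v'(r)|^{q−1} ∫_r^∞ s^{k₁−2}|u'(s)|^{p−1} ds + r^N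 ∫_r^∞ s^{k₁−2}|v'(s)|^{q−1} v(s)^δ ds + r^N ∫_r^∞ s^{k₁−2}|u'(s)|^{p−1} u(s)^μ ds. Then E₁ is differentiable on (0,∞) and for every r > 0: E₁'(r) = (k₁ − N + N/(δ+1) + N/(μ+1)) r^{N+k₁−3}|u'(r)|^{p−1}|v'(r)|^{q−1} − (N/(δ+1)) r^{N−1} v(r)^δ ∫_r^∞ s^{k₁−2}|v'(s)|^{q−1} ds + N r^{N−1} ∫_r^∞ s^{k₁−2}|v'(s)|^{q−1} v(s)^δ ds − (N/(μ+1)) r^{N−1} u(r)^μ ∫_r^∞ s^{k₁−2}|u'(s)|^{p−1} ds + N r^{N−1} ∫_r^∞ s^{k₁−2}|u'(s)|^{p−1} u(s)^μ ds. -/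
open MeasureTheory Set Filter Topology

/-- A radial profile whose weighted flux is strictly decreasing has negative derivative. -/
theorem deriv_neg_of_flux {n p : ℝ} (hn : 0 < n) (hp : 1 < p) {u g : ℝ → ℝ}
    (hu : ContDiffOn ℝ 1 u (Ici 0)) (hg : ∀ r, 0 < r → 0 < g r)
    (hode : ∀ r, 0 < r →
      deriv (fun s => s ^ n * |deriv u s| ^ (p - 2) * deriv u s) r = -g r) :
    ∀ r, 0 < r → deriv u r < 0 := by
  set w : ℝ → ℝ := fun s => s ^ n * |deriv u s| ^ (p - 2) * deriv u s with hw
  have hdiff : ∀ r, 0 < r → DifferentiableAt ℝ w r := fun r hr =>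
    differentiableAt_of_deriv_ne_zero (by rw [hode r hr]; exact (neg_neg_of_pos (hg r hr)).ne)
  have hanti : StrictAntiOn w (Ioi 0) := by
    refine strictAntiOn_of_deriv_neg (convex_Ioi 0)
      (fun r hr => (hdiff r hr).continuousAt.continuousWithinAt) fun r hr => ?_
    rw [interior_Ioi] at hr
    rw [hode r hr]
    exact neg_neg_of_pos (hg r hr)
  have hlim : Tendsto w (𝓝[>] 0) (𝓝 0) := by
    have hd : Tendsto (derivWithin u (Ici 0)) (𝓝[>] 0) (𝓝 (derivWithin u (Ici 0) 0)) :=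
      ((hu.continuousOn_derivWithin (uniqueDiffOn_Ici 0) le_rfl) 0 self_mem_Ici).mono_left
        (nhdsWithin_mono _ Ioi_subset_Ici_self)
    have hs : Tendsto (fun s : ℝ => s ^ n) (𝓝[>] 0) (𝓝 0) := by
      have := (Real.continuousAt_rpow_const 0 n (Or.inr hn.le)).tendsto
      rw [Real.zero_rpow hn.ne'] at this
      exact this.mono_left nhdsWithin_le_nhds
    have hbound := hs.mul (hd.abs.rpow_const (p := p - 1) (Or.inr (by linarith)))
    rw [zero_mul] at hbound
    refine squeeze_zero_norm' ?_ hbound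
    filter_upwards [self_mem_nhdsWithin] with s hs
    have hs : 0 < s := hs
    rw [derivWithin_of_mem_nhds (Ici_mem_nhds hs), hw, Real.norm_eq_abs]
    simp only [abs_mul, abs_of_nonneg (Real.rpow_nonneg hs.le n),
      abs_of_nonneg (Real.rpow_nonneg (abs_nonneg (deriv u s)) (p - 2)), mul_assoc]
    rcases eq_or_ne (deriv u s) 0 with h | h
    · simp only [h, abs_zero, mul_zero]
      positivity
    · rw [← Real.rpow_add_one (abs_pos.2 h).ne']
      ring_nf
      exact le_rfl
  intro r hr
  have hneg : w r < 0 := by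
    refine (hanti (half_pos hr) hr (half_lt_self hr)).trans_le (ge_of_tendsto hlim ?_)
    filter_upwards [Ioo_mem_nhdsGT (half_pos hr)] with s hs
    exact (hanti hs.1 (half_pos hr) hs.2).le
  by_contra! h
  exact hneg.not_ge (by positivity)

/-- The flux equation, rewritten for a profile with negative derivative. -/
theorem hasDerivAt_flux {n p : ℝ} {u g : ℝ → ℝ} (hneg : ∀ r, 0 < r → deriv u r < 0)
    (hg : ∀ r, 0 < r → 0 < g r)
    (hode : ∀ r, 0 < r →
      deriv (fun s => s ^ n * |deriv u s| ^ (p - 2) * deriv u s) r = -g r)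
    {r : ℝ} (hr : 0 < r) :
    HasDerivAt (fun s => s ^ n * |deriv u s| ^ (p - 1)) (g r) r := by
  have hd := (differentiableAt_of_deriv_ne_zero
    (by rw [hode r hr]; exact (neg_neg_of_pos (hg r hr)).ne)).hasDerivAt.neg
  rw [hode r hr, neg_neg] at hd
  refine hd.congr_of_eventuallyEq ?_
  filter_upwards [Ioi_mem_nhds hr] with s hs
  have h := hneg s hs
  have : |deriv u s| ^ (p - 1) = |deriv u s| ^ (p - 2) * |deriv u s| := by
    rw [← Real.rpow_add_one (abs_pos.2 h.ne).ne']
    ring_nf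
  rw [this, Pi.neg_apply, abs_of_neg h]
  ring

theorem integrableOn_Ioi_of_continuousOn {f : ℝ → ℝ} {c : ℝ} (hf : ContinuousOn f (Ioi 0))
    (hi : IntegrableOn f (Ioi c)) {r : ℝ} (hr : 0 < r) : IntegrableOn f (Ioi r) := by
  have h : IntegrableOn f (Icc r c) :=
    (hf.mono fun x hx => hr.trans_le hx.1).integrableOn_Icc
  refine (h.union hi).mono_set fun x hx => ?_
  rcases le_or_gt x c with hxc | hxc
  · exact Or.inl ⟨le_of_lt hx, hxc⟩
  · exact Or.inr hxc

theorem hasDerivAt_integral_Ioi {f : ℝ → ℝ} {c : ℝ} (hf : ContinuousOn f (Ioi 0))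
    (hi : IntegrableOn f (Ioi c)) {r : ℝ} (hr : 0 < r) :
    HasDerivAt (fun t => ∫ s in Ioi t, f s) (-f r) r := by
  have hc : ContinuousAt f r := hf.continuousAt (Ioi_mem_nhds hr)
  have hint := integrableOn_Ioi_of_continuousOn hf hi (half_pos hr)
  have hd : HasDerivAt (fun t => ∫ s in (r / 2)..t, f s) (f r) r :=
    intervalIntegral.integral_hasDerivAt_right
      ((intervalIntegrable_iff_integrableOn_Ioc_of_le (half_le_self hr.le)).2
        (hint.mono_set Ioc_subset_Ioi_self))
      (hf.stronglyMeasurableAtFilter isOpen_Ioi r hr) hc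
  refine (hd.const_sub (∫ s in Ioi (r / 2), f s)).congr_of_eventuallyEq ?_
  filter_upwards [Ioi_mem_nhds (half_lt_self hr)] with t ht
  have := intervalIntegral.integral_Ioi_sub_Ioi hint (le_of_lt ht)
  linarith

/-- Multiplying by a nonnegative power of a positive nonincreasing profile preserves
integrability at infinity. -/
theorem integrableOn_mul_rpow {f v : ℝ → ℝ} {δ : ℝ} (hδ : 0 ≤ δ)
    (hi : IntegrableOn f (Ioi 1)) (hv : ContinuousOn v (Ioi 0)) (hpos : ∀ r, 0 ≤ r → 0 < v r)
    (hneg : ∀ r, 0 < r → deriv v r < 0) :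
    IntegrableOn (fun s => f s * v s ^ δ) (Ioi 1) := by
  have hanti : StrictAntiOn v (Ioi 0) :=
    strictAntiOn_of_deriv_neg (convex_Ioi 0) hv fun r hr => hneg r (interior_subset hr)
  have hsub : Ioi (1 : ℝ) ⊆ Ioi 0 := Ioi_subset_Ioi zero_le_one
  refine Integrable.mul_bdd (c := v 1 ^ δ) hi ?_ ?_
  · exact ((hv.mono hsub).rpow_const fun x _ => Or.inr hδ).aestronglyMeasurable
      measurableSet_Ioi
  · filter_upwards [ae_restrict_mem measurableSet_Ioi] with s hs
    have hs0 : (0 : ℝ) < s := hsub hs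
    rw [Real.norm_of_nonneg (Real.rpow_nonneg (hpos s hs0.le).le δ)]
    exact Real.rpow_le_rpow (hpos s hs0.le).le
      (hanti.antitoneOn (mem_Ioi.2 one_pos) hs0 (le_of_lt hs)) hδ

theorem continuousOn_weight {u : ℝ → ℝ} {k p : ℝ} (hp : 1 < p)
    (hu : ContDiffOn ℝ 2 u (Ioi 0)) :
    ContinuousOn (fun s => s ^ (k - 2) * |deriv u s| ^ (p - 1)) (Ioi 0) := by
  refine (continuousOn_id.rpow_const fun x hx => Or.inl (ne_of_gt hx)).mul ?_
  exact (hu.continuousOn_deriv_of_isOpen isOpen_Ioi (by norm_num)).abs.rpow_const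
    fun x _ => Or.inr (by linarith)

/-- The energy identity in terms of the absolute fluxes `a`, `b` and the sources `f`, `g`. -/
theorem hasDerivAt_energy {n k c d r : ℝ} {a b f g A B C D : ℝ → ℝ} (hr : 0 < r)
    (ha : HasDerivAt (fun s => s ^ (n - 1) * a s) (r ^ (n - 1) * f r) r)
    (hb : HasDerivAt (fun s => s ^ (n - 1) * b s) (r ^ (n - 1) * g r) r)
    (hA : HasDerivAt A (-(r ^ (k - 2) * a r)) r)
    (hB : HasDerivAt B (-(r ^ (k - 2) * b r)) r)
    (hC : HasDerivAt C (-(r ^ (k - 2) * b r * f r)) r)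
    (hD : HasDerivAt D (-(r ^ (k - 2) * a r * g r)) r) :
    HasDerivAt (fun t => t ^ (n + k - 2) * a t * b t - c * t ^ (n - 1) * a t * B t
        - d * t ^ (n - 1) * b t * A t + t ^ n * C t + t ^ n * D t)
      ((k - n + c + d) * r ^ (n + k - 3) * a r * b r - c * r ^ (n - 1) * f r * B r
        + n * r ^ (n - 1) * C r - d * r ^ (n - 1) * g r * A r + n * r ^ (n - 1) * D r) r := by
  have hpow : ∀ e : ℝ, HasDerivAt (fun t : ℝ => t ^ e) (e * r ^ (e - 1)) r := fun e =>
    Real.hasDerivAt_rpow_const (Or.inl hr.ne')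
  have key := (((((hpow (k - n)).mul ha).mul hb).sub ((ha.const_mul c).mul hB)).sub
    ((hb.const_mul d).mul hA)).add ((hpow n).mul hC) |>.add ((hpow n).mul hD)
  refine (key.congr_of_eventuallyEq ?_).congr_deriv ?_
  · filter_upwards [Ioi_mem_nhds hr] with t ht
    have ht : 0 < t := ht
    have h : t ^ (n + k - 2) = t ^ (k - n) * t ^ (n - 1) * t ^ (n - 1) := by
      rw [← Real.rpow_add ht, ← Real.rpow_add ht]
      ring_nf
    simp only [Pi.add_apply, Pi.sub_apply, Pi.mul_apply, h]
    ring
  · have h₁ : r ^ (k - n - 1) = r ^ (k - n) / r := Real.rpow_sub_one hr.ne' _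
    have h₂ : r ^ n = r ^ (n - 1) * r := by
      rw [← Real.rpow_add_one hr.ne']; ring_nf
    have h₃ : r ^ (k - 2) = r ^ (k - n) * r ^ (n - 1) / r := by
      rw [← Real.rpow_add hr, ← Real.rpow_sub_one hr.ne']; ring_nf
    have h₄ : r ^ (n + k - 3) = r ^ (k - n) * r ^ (n - 1) * r ^ (n - 1) / r := by
      rw [← Real.rpow_add hr, ← Real.rpow_add hr, ← Real.rpow_sub_one hr.ne']; ring_nf
    simp only [Pi.mul_apply, h₁, h₂, h₃, h₄]
    field_simp
    ring

/-- Lemma 2.1: the Pohozaev-type energy identity on `(0,∞)`. -/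
theorem pohozaev_identity_infty (N : ℕ) (hN : 2 ≤ N) (p q δ μ k₁ : ℝ)
    (hδ : 0 < δ) (hμ : 0 < μ)
    (hcase : (2 * (N : ℝ) / (N + 1) ≤ p ∧ p ≤ q ∧ q ≤ 2 ∧
                k₁ = p + ((N : ℝ) - p) * (p - 2) / (p - 1)) ∨
             (2 ≤ p ∧ p ≤ q ∧ q < (N : ℝ) ∧ k₁ = q / (q - 1)))
    (u v : ℝ → ℝ)
    (hu1 : ContDiffOn ℝ 1 u (Set.Ici 0)) (hv1 : ContDiffOn ℝ 1 v (Set.Ici 0))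
    (hu2 : ContDiffOn ℝ 2 u (Set.Ioi 0)) (hv2 : ContDiffOn ℝ 2 v (Set.Ioi 0))
    (hupos : ∀ r : ℝ, 0 ≤ r → 0 < u r) (hvpos : ∀ r : ℝ, 0 ≤ r → 0 < v r)
    (hodeu : ∀ r : ℝ, 0 < r →
      deriv (fun s => s ^ ((N:ℝ) - 1) * |deriv u s| ^ (p - 2) * deriv u s) r
        = -(r ^ ((N:ℝ) - 1) * v r ^ δ))
    (hodev : ∀ r : ℝ, 0 < r →
      deriv (fun s => s ^ ((N:ℝ) - 1) * |deriv v s| ^ (q - 2) * deriv v s) r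
        = -(r ^ ((N:ℝ) - 1) * u r ^ μ))
    (hintu : IntegrableOn (fun s => s ^ (k₁ - 2) * |deriv u s| ^ (p - 1)) (Set.Ioi 1))
    (hintv : IntegrableOn (fun s => s ^ (k₁ - 2) * |deriv v s| ^ (q - 1)) (Set.Ioi 1)) :
    ∀ r : ℝ, 0 < r →
      HasDerivAt (fun t =>
          t ^ ((N:ℝ) + k₁ - 2) * |deriv u t| ^ (p - 1) * |deriv v t| ^ (q - 1)
          - ((N:ℝ) / (δ + 1)) * t ^ ((N:ℝ) - 1) * |deriv u t| ^ (p - 1) *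
              (∫ s in Set.Ioi t, s ^ (k₁ - 2) * |deriv v s| ^ (q - 1))
          - ((N:ℝ) / (μ + 1)) * t ^ ((N:ℝ) - 1) * |deriv v t| ^ (q - 1) *
              (∫ s in Set.Ioi t, s ^ (k₁ - 2) * |deriv u s| ^ (p - 1))
          + t ^ (N:ℝ) * (∫ s in Set.Ioi t, s ^ (k₁ - 2) * |deriv v s| ^ (q - 1) * v s ^ δ)
          + t ^ (N:ℝ) * (∫ s in Set.Ioi t, s ^ (k₁ - 2) * |deriv u s| ^ (p - 1) * u s ^ μ))
        ((k₁ - N + (N:ℝ) / (δ + 1) + (N:ℝ) / (μ + 1)) * r ^ ((N:ℝ) + k₁ - 3) *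
              |deriv u r| ^ (p - 1) * |deriv v r| ^ (q - 1)
          - ((N:ℝ) / (δ + 1)) * r ^ ((N:ℝ) - 1) * v r ^ δ *
              (∫ s in Set.Ioi r, s ^ (k₁ - 2) * |deriv v s| ^ (q - 1))
          + (N:ℝ) * r ^ ((N:ℝ) - 1) *
              (∫ s in Set.Ioi r, s ^ (k₁ - 2) * |deriv v s| ^ (q - 1) * v s ^ δ)
          - ((N:ℝ) / (μ + 1)) * r ^ ((N:ℝ) - 1) * u r ^ μ *
              (∫ s in Set.Ioi r, s ^ (k₁ - 2) * |deriv u s| ^ (p - 1))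
          + (N:ℝ) * r ^ ((N:ℝ) - 1) *
              (∫ s in Set.Ioi r, s ^ (k₁ - 2) * |deriv u s| ^ (p - 1) * u s ^ μ)) r := by
  have hNr : (2 : ℝ) ≤ N := by exact_mod_cast hN
  have hpq : 1 < p ∧ 1 < q := by
    rcases hcase with ⟨h, hle, -⟩ | ⟨h, hle, -⟩
    · have : 1 < 2 * (N : ℝ) / (N + 1) := by rw [lt_div_iff₀ (by linarith)]; linarith
      constructor <;> linarith
    · constructor <;> linarith
  obtain ⟨hp, hq⟩ := hpq
  have hgu : ∀ r : ℝ, 0 < r → 0 < r ^ ((N : ℝ) - 1) * v r ^ δ := fun r hr =>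
    mul_pos (Real.rpow_pos_of_pos hr _) (Real.rpow_pos_of_pos (hvpos r hr.le) _)
  have hgv : ∀ r : ℝ, 0 < r → 0 < r ^ ((N : ℝ) - 1) * u r ^ μ := fun r hr =>
    mul_pos (Real.rpow_pos_of_pos hr _) (Real.rpow_pos_of_pos (hupos r hr.le) _)
  have hun := deriv_neg_of_flux (by linarith) hp hu1 hgu hodeu
  have hvn := deriv_neg_of_flux (by linarith) hq hv1 hgv hodev
  have hcu := continuousOn_weight (k := k₁) hp hu2
  have hcv := continuousOn_weight (k := k₁) hq hv2
  intro r hr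
  refine hasDerivAt_energy (f := fun s => v s ^ δ) (g := fun s => u s ^ μ)
    (a := fun s => |deriv u s| ^ (p - 1)) (b := fun s => |deriv v s| ^ (q - 1)) hr
    (hasDerivAt_flux hun hgu hodeu hr) (hasDerivAt_flux hvn hgv hodev hr)
    (hasDerivAt_integral_Ioi hcu hintu hr) (hasDerivAt_integral_Ioi hcv hintv hr) ?_ ?_
  · exact hasDerivAt_integral_Ioi
      (hcv.mul (hv2.continuousOn.rpow_const fun _ _ => Or.inr hδ.le))
      (integrableOn_mul_rpow hδ.le hintv hv2.continuousOn hvpos hvn) hr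
  · exact hasDerivAt_integral_Ioi
      (hcu.mul (hu2.continuousOn.rpow_const fun _ _ => Or.inr hμ.le))
      (integrableOn_mul_rpow hμ.le hintu hu2.continuousOn hupos hun) hr
end
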